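/- Assume the Open Colouring Axiom (OCA). Let φ : ℳ → P(ℕ)/fin be a Boolean-algebra embedding and let {A_α : α < ω₁} enumerate a neat almost disjoint family of infinite subsets of ℕ. Then for every f ∈ ω^ω there is β < ω₁ such that for every α ≥ β there is a lifting Φ of φ satisfying: Φ(O) = Φ[O] whenever O ⊆ B_{f,A_α} = {(n,s) : n ∈ A_α, s ∈ 2^{f(n)}}, and Φ(n,s) ∩ Φ(m,t) = ∅ whenever the basic sets {n} × [s] and {m} × [t] are disjoint. -/

import Mathlib

open Set MeasureTheory
open scoped ENNReal

namespace Paper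

/-- The Open Colouring Axiom: for every separable metrizable space `X` and every
partition `[X]² = K₀ ∪ K₁` of the unordered pairs with `K₀` open (coded here as a
symmetric open set `K ⊆ X × X` off the diagonal), either there is an uncountable
`K₀`-homogeneous set, or `X` is a countable union of `K₁`-homogeneous sets. -/
def OCA : Prop :=
  ∀ (X : Type) [MetricSpace X] [TopologicalSpace.SeparableSpace X],
    ∀ K : Set (X × X), IsOpen K → (∀ a b : X, (a, b) ∈ K → (b, a) ∈ K) →
      (∀ a : X, (a, a) ∉ K) →
      (∃ Y : Set X, ¬Y.Countable ∧ ∀ a ∈ Y, ∀ b ∈ Y, a ≠ b → (a, b) ∈ K) ∨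
      (∃ Y : ℕ → Set X, (⋃ n, Y n) = Set.univ ∧
        ∀ (n : ℕ), ∀ a ∈ Y n, ∀ b ∈ Y n, a ≠ b → (a, b) ∉ K)

/-- `X` and `Y` agree modulo a finite set. -/
def AlmostEq {α : Type} (X Y : Set α) : Prop := (symmDiff X Y).Finite

/-- the "equal mod finite" setoid on `Set α` -/
def finSetoid (α : Type) : Setoid (Set α) where
  r X Y := (symmDiff X Y).Finite
  iseqv := by
    constructor
    · intro X; simp
    · intro X Y h; rwa [symmDiff_comm]
    · intro X Y Z h1 h2
      exact (h1.union h2).subset (symmDiff_triangle X Y Z)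

/-- the quotient Boolean algebra `P(α)/fin` -/
def PFin (α : Type) : Type := Quotient (finSetoid α)

/-- the class of `X` in `P(α)/fin` -/
def PFin.mk {α : Type} (X : Set α) : PFin α := Quotient.mk (finSetoid α) X

/-- join in `P(α)/fin` -/
def PFin.sup {α : Type} : PFin α → PFin α → PFin α :=
  Quotient.lift₂ (fun X Y => PFin.mk (X ∪ Y))
    (by
      intro X Y X' Y' hX hY
      refine Quotient.sound ?_
      have hX' : (symmDiff X X').Finite := hX
      have hY' : (symmDiff Y Y').Finite := hY
      show (symmDiff (X ∪ Y) (X' ∪ Y')).Finite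
      refine (hX'.union hY').subset ?_
      intro x hx
      simp only [Set.mem_symmDiff, Set.mem_union] at hx ⊢
      tauto)

/-- meet in `P(α)/fin` -/
def PFin.inf {α : Type} : PFin α → PFin α → PFin α :=
  Quotient.lift₂ (fun X Y => PFin.mk (X ∩ Y))
    (by
      intro X Y X' Y' hX hY
      refine Quotient.sound ?_
      have hX' : (symmDiff X X').Finite := hX
      have hY' : (symmDiff Y Y').Finite := hY
      show (symmDiff (X ∩ Y) (X' ∩ Y')).Finite
      refine (hX'.union hY').subset ?_
      intro x hx
      simp only [Set.mem_symmDiff, Set.mem_inter_iff, Set.mem_union] at hx ⊢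
      tauto)

/-- complement in `P(α)/fin` -/
def PFin.compl {α : Type} : PFin α → PFin α :=
  Quotient.lift (fun X => PFin.mk Xᶜ)
    (by
      intro X Y h
      refine Quotient.sound ?_
      have h' : (symmDiff X Y).Finite := h
      show (symmDiff Xᶜ Yᶜ).Finite
      have e : symmDiff Xᶜ Yᶜ = symmDiff X Y := by
        ext x; simp only [Set.mem_symmDiff, Set.mem_compl_iff]; tauto
      rw [e]; exact h')

/-- bottom of `P(α)/fin` -/
def PFin.bot {α : Type} : PFin α := PFin.mk (∅ : Set α)

/-- top of `P(α)/fin` -/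
def PFin.top {α : Type} : PFin α := PFin.mk (Set.univ : Set α)

/-- the Cantor set `2^ω` -/
abbrev Cant : Type := ℕ → Bool

/-- the space `C = ω × 2^ω` -/
abbrev CSp : Type := ℕ × Cant

/-- the cylinder set `[s] = {x : s ⊂ x}` determined by a finite binary sequence -/
def cyl (s : List Bool) : Set Cant := {x | ∀ i : Fin s.length, x i.1 = s.get i}

/-- the basic clopen set `{n} × [s]` of `C` -/
def basic (n : ℕ) (s : List Bool) : Set CSp := {n} ×ˢ cyl s

lemma measurableSet_cyl (s : List Bool) : MeasurableSet (cyl s) := by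
  have h : cyl s = ⋂ i : Fin s.length, (fun x : Cant => x i.1) ⁻¹' {s.get i} := by
    ext x; simp [cyl]
  rw [h]
  exact MeasurableSet.iInter fun i => (measurable_pi_apply i.1) (measurableSet_singleton _)

lemma measurableSet_basic (n : ℕ) (s : List Bool) : MeasurableSet (basic n s) :=
  (measurableSet_singleton n).prod (measurableSet_cyl s)

/-- a measure on `C` is the right one when it gives each basic set `{n} × [s]`
measure `2^{-|s|}` (this determines the measure on all Borel sets). -/
def IsMeasureOK (μ : Measure CSp) : Prop :=
  ∀ (n : ℕ) (s : List Bool), μ (basic n s) = (2 : ℝ≥0∞)⁻¹ ^ s.length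

/-- Borel subsets of `C` -/
abbrev BSet : Type := {A : Set CSp // MeasurableSet A}

/-- the "equal modulo a null set" setoid on Borel sets of `C` -/
def measSetoid (μ : Measure CSp) : Setoid BSet where
  r A B := μ (symmDiff (A : Set CSp) (B : Set CSp)) = 0
  iseqv := by
    constructor
    · intro A; simp
    · intro A B h; rwa [symmDiff_comm]
    · intro A B C h1 h2
      exact measure_mono_null (symmDiff_triangle (A : Set CSp) (B : Set CSp) (C : Set CSp))
        (measure_union_null h1 h2)

/-- the measure algebra `ℳ = Bor(C)/𝒩` -/
def MAlg (μ : Measure CSp) : Type := Quotient (measSetoid μ)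

/-- the class of a Borel set in the measure algebra -/
def MAlg.mk (μ : Measure CSp) (A : BSet) : MAlg μ := Quotient.mk (measSetoid μ) A

variable {μ : Measure CSp}

/-- join in the measure algebra -/
def MAlg.sup : MAlg μ → MAlg μ → MAlg μ :=
  Quotient.lift₂ (fun A B : BSet => MAlg.mk μ ⟨(A : Set CSp) ∪ (B : Set CSp), A.2.union B.2⟩)
    (by
      intro A B A' B' hA hB
      refine Quotient.sound ?_
      have hA' : μ (symmDiff (A : Set CSp) (A' : Set CSp)) = 0 := hA
      have hB' : μ (symmDiff (B : Set CSp) (B' : Set CSp)) = 0 := hB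
      show μ (symmDiff ((A : Set CSp) ∪ (B : Set CSp)) ((A' : Set CSp) ∪ (B' : Set CSp))) = 0
      refine measure_mono_null ?_ (measure_union_null hA' hB')
      intro x hx
      simp only [Set.mem_symmDiff, Set.mem_union] at hx ⊢
      tauto)

/-- meet in the measure algebra -/
def MAlg.inf : MAlg μ → MAlg μ → MAlg μ :=
  Quotient.lift₂ (fun A B : BSet => MAlg.mk μ ⟨(A : Set CSp) ∩ (B : Set CSp), A.2.inter B.2⟩)
    (by
      intro A B A' B' hA hB
      refine Quotient.sound ?_
      have hA' : μ (symmDiff (A : Set CSp) (A' : Set CSp)) = 0 := hA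
      have hB' : μ (symmDiff (B : Set CSp) (B' : Set CSp)) = 0 := hB
      show μ (symmDiff ((A : Set CSp) ∩ (B : Set CSp)) ((A' : Set CSp) ∩ (B' : Set CSp))) = 0
      refine measure_mono_null ?_ (measure_union_null hA' hB')
      intro x hx
      simp only [Set.mem_symmDiff, Set.mem_inter_iff, Set.mem_union] at hx ⊢
      tauto)

/-- complement in the measure algebra -/
def MAlg.compl : MAlg μ → MAlg μ :=
  Quotient.lift (fun A : BSet => MAlg.mk μ ⟨(A : Set CSp)ᶜ, A.2.compl⟩)
    (by
      intro A B h
      refine Quotient.sound ?_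
      have h' : μ (symmDiff (A : Set CSp) (B : Set CSp)) = 0 := h
      show μ (symmDiff (A : Set CSp)ᶜ (B : Set CSp)ᶜ) = 0
      have e : symmDiff (A : Set CSp)ᶜ (B : Set CSp)ᶜ = symmDiff (A : Set CSp) (B : Set CSp) := by
        ext x; simp only [Set.mem_symmDiff, Set.mem_compl_iff]; tauto
      rw [e]; exact h')

/-- bottom of the measure algebra -/
def MAlg.bot : MAlg μ := MAlg.mk μ ⟨∅, MeasurableSet.empty⟩

/-- top of the measure algebra -/
def MAlg.top : MAlg μ := MAlg.mk μ ⟨Set.univ, MeasurableSet.univ⟩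

/-- `φ : ℳ → P(ℕ)/fin` is a Boolean-algebra embedding -/
structure IsEmbedding (μ : Measure CSp) (φ : MAlg μ → PFin ℕ) : Prop where
  injective : Function.Injective φ
  map_sup : ∀ a b, φ (MAlg.sup a b) = PFin.sup (φ a) (φ b)
  map_inf : ∀ a b, φ (MAlg.inf a b) = PFin.inf (φ a) (φ b)
  map_compl : ∀ a, φ (MAlg.compl a) = PFin.compl (φ a)
  map_bot : φ MAlg.bot = PFin.bot
  map_top : φ MAlg.top = PFin.top

/-- the open subset of `C` coded by a set `O` of pairs `(n,s)` -/
def openSet (O : Set (ℕ × List Bool)) : Set CSp := ⋃ p ∈ O, basic p.1 p.2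

lemma measurableSet_openSet (O : Set (ℕ × List Bool)) : MeasurableSet (openSet O) :=
  MeasurableSet.biUnion O.to_countable fun p _ => measurableSet_basic p.1 p.2

/-- the element of the measure algebra coded by `O` -/
def classOf (μ : Measure CSp) (O : Set (ℕ × List Bool)) : MAlg μ :=
  MAlg.mk μ ⟨openSet O, measurableSet_openSet O⟩

/-- `Φ` is a lifting of `φ : ℳ → P(ℕ)/fin`: it chooses a representative of `φ a` for every `a` -/
def IsLifting {μ : Measure CSp} (φ : MAlg μ → PFin ℕ) (Φ : MAlg μ → Set ℕ) : Prop :=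
  ∀ a, PFin.mk (Φ a) = φ a

/-- `Φ(O)`: the value of `Φ` at the class of the open set coded by `O` -/
def PhiSet {μ : Measure CSp} (Φ : MAlg μ → Set ℕ) (O : Set (ℕ × List Bool)) : Set ℕ :=
  Φ (classOf μ O)

/-- `Φ(n,s)` -/
def PhiPt {μ : Measure CSp} (Φ : MAlg μ → Set ℕ) (n : ℕ) (s : List Bool) : Set ℕ :=
  Φ (classOf μ {(n, s)})

/-- `Φ[O] = ⋃ {Φ(n,s) : (n,s) ∈ O}` -/
def PhiUnion {μ : Measure CSp} (Φ : MAlg μ → Set ℕ) (O : Set (ℕ × List Bool)) : Set ℕ :=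
  ⋃ p ∈ O, PhiPt Φ p.1 p.2

/-- the layer `B_f = {(n,s) : s ∈ 2^{f(n)}}` -/
def Bf (f : ℕ → ℕ) : Set (ℕ × List Bool) := {p | p.2.length = f p.1}

/-- the layer `B_{f,A} = {(n,s) : n ∈ A, s ∈ 2^{f(n)}}` -/
def BfA (f : ℕ → ℕ) (A : Set ℕ) : Set (ℕ × List Bool) := {p | p.1 ∈ A ∧ p.2.length = f p.1}

/-- the first uncountable ordinal -/
noncomputable def omega1 : Ordinal := (Cardinal.aleph 1).ord

section Helpers

open Filter Topology



/-- points of an open subset of a sequence space have cylinder neighbourhoods -/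
lemma exists_cyl {α : Type*} [TopologicalSpace α] [DiscreteTopology α] {U : Set (ℕ → α)}
    (hU : IsOpen U) {x : ℕ → α} (hx : x ∈ U) :
    ∃ L : ℕ, ∀ x' : ℕ → α, (∀ i < L, x' i = x i) → x' ∈ U := by
  rw [isOpen_pi_iff] at hU
  obtain ⟨I, u, hu, hsub⟩ := hU x hx
  refine ⟨I.sup id + 1, fun x' hx' => hsub ?_⟩
  intro i hi
  rw [hx' i (Nat.lt_succ_of_le (Finset.le_sup (f := id) hi))]
  exact (hu i hi).2

lemma isOpen_cyl' {α : Type*} [TopologicalSpace α] [DiscreteTopology α] (z : ℕ → α) (L : ℕ) :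
    IsOpen {x : ℕ → α | ∀ i < L, x i = z i} := by
  have : {x : ℕ → α | ∀ i < L, x i = z i} = Set.pi (Set.Iio L) (fun i => {z i}) := by
    ext x; simp [Set.mem_pi]
  rw [this]
  exact isOpen_set_pi (Set.finite_Iio L) (fun i _ => isOpen_discrete _)

lemma dense_cyl {α : Type*} [TopologicalSpace α] [DiscreteTopology α] {D : Set (ℕ → α)}
    (hD : Dense D) (z : ℕ → α) (L : ℕ) : ∃ x ∈ D, ∀ i < L, x i = z i := by
  obtain ⟨x, hx, hx'⟩ := hD.inter_open_nonempty _ (isOpen_cyl' z L) ⟨z, fun _ _ => rfl⟩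
  exact ⟨x, hx', hx⟩

lemma isOpenMap_pm {α β : Type*} [TopologicalSpace α] [TopologicalSpace β] [DiscreteTopology β]
    (h : ℕ → α → β) (hs : ∃ L, ∀ i, L ≤ i → Function.Surjective (h i)) :
    IsOpenMap (fun (p : ℕ → α) i => h i (p i)) := by
  apply IsOpenMap.piMap (f := h) (fun i U _ => isOpen_discrete _)
  obtain ⟨L, hL⟩ := hs
  rw [Nat.cofinite_eq_atTop]
  exact eventually_atTop.2 ⟨L, hL⟩

lemma continuous_pm {α β : Type*} [TopologicalSpace α] [TopologicalSpace β] [DiscreteTopology α]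
    (h : ℕ → α → β) : Continuous (fun (p : ℕ → α) i => h i (p i)) :=
  continuous_pi fun i => (continuous_of_discreteTopology (f := h i)).comp (continuous_apply i)

lemma surj_fst : Function.Surjective (fun p : Bool × Bool => p.1) := fun b => ⟨(b, b), rfl⟩
lemma surj_snd : Function.Surjective (fun p : Bool × Bool => p.2) := fun b => ⟨(b, b), rfl⟩
lemma surj_or : Function.Surjective (fun p : Bool × Bool => p.1 || p.2) :=
  fun b => ⟨(b, b), by simp⟩
lemma surj_and : Function.Surjective (fun p : Bool × Bool => p.1 && p.2) :=
  fun b => ⟨(b, b), by simp⟩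

/-- finite dependence -/
lemma dep_aux (op : Bool → Bool → Bool) (c : Bool) (hop : ∀ t, op t c = c) (hid : ∀ t, op t t = t)
    {U1 V1 U3 V3 : Set (ℕ → Bool)} (hU1 : IsOpen U1) (hV1 : IsOpen V1)
    (hD : Dense (U3 ∪ V3)) (y0 : ℕ → Bool) (L : ℕ)
    (h : ∀ x y : ℕ → Bool, (∀ i < L, y i = y0 i) →
      (x ∈ U1 → (fun i => op (x i) (y i)) ∉ V3) ∧ (x ∈ V1 → (fun i => op (x i) (y i)) ∉ U3))
    {x x' : ℕ → Bool} (hx : x ∈ U1) (hx' : x' ∈ V1) : ¬ (∀ i < L, x i = x' i) := by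
  intro hag
  obtain ⟨L1, h1⟩ := exists_cyl hU1 hx
  obtain ⟨L2, h2⟩ := exists_cyl hV1 hx'
  set L' := L + L1 + L2 with hL'
  obtain ⟨v, hv, hvL⟩ := dense_cyl hD (fun i => if i < L then op (x i) (y0 i) else c) L'
  let y : ℕ → Bool := fun i => if i < L then y0 i else v i
  have hy : ∀ i < L, y i = y0 i := fun i hi => by simp [y, hi]
  let xa : ℕ → Bool := fun i => if i < L' then x i else v i
  let xb : ℕ → Bool := fun i => if i < L' then x' i else v i
  have hxa : xa ∈ U1 := h1 _ fun i hi => by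
    have : i < L' := by omega
    simp [xa, this]
  have hxb : xb ∈ V1 := h2 _ fun i hi => by
    have : i < L' := by omega
    simp [xb, this]
  have ea : (fun i => op (xa i) (y i)) = v := by
    funext i
    by_cases hi : i < L
    · have hi' : i < L' := by omega
      have := hvL i hi'
      simp [xa, y, hi, hi'] at this ⊢
      exact this.symm
    · by_cases hi' : i < L'
      · have := hvL i hi'
        simp [xa, y, hi, hi'] at this ⊢
        rw [this, hop]
      · simp [xa, y, hi, hi', hid]
  have eb : (fun i => op (xb i) (y i)) = v := by
    rw [← ea]
    funext i
    by_cases hi : i < L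
    · have hi' : i < L' := by omega
      simp [xa, xb, y, hi, hi', hag i hi]
    · by_cases hi' : i < L'
      · have := hvL i hi'
        simp [xa, xb, y, hi, hi'] at this ⊢
        rw [this, hop, hop]
      · simp [xa, xb, hi']
  have ha := (h xa y hy).1 hxa
  have hb := (h xb y hy).2 hxb
  rw [ea] at ha
  rw [eb] at hb
  rcases hv with hv | hv
  · exact hb hv
  · exact ha hv

lemma dep_all {U1 V1 U2 V2 U3 V3 U4 V4 : Set (ℕ → Bool)}
    (hU1 : IsOpen U1) (hV1 : IsOpen V1) (hU2 : IsOpen U2) (hV2 : IsOpen V2)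
    (hD2 : Dense (U2 ∪ V2))
    (hD3 : Dense (U3 ∪ V3)) (hD4 : Dense (U4 ∪ V4))
    (c1 : ∀ x y : ℕ → Bool, x ∈ U1 → (fun i => x i || y i) ∉ V3)
    (c3 : ∀ x y : ℕ → Bool, x ∈ V1 → y ∈ V2 → (fun i => x i || y i) ∉ U3)
    (c4 : ∀ x y : ℕ → Bool, x ∈ U1 → y ∈ U2 → (fun i => x i && y i) ∉ V4)
    (c5 : ∀ x y : ℕ → Bool, x ∈ V1 → (fun i => x i && y i) ∉ U4) :
    ∃ L : ℕ, ∀ L' ≥ L, ∀ x ∈ U1, ∀ x' ∈ V1, ¬ ∀ i < L', x i = x' i := by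
  obtain ⟨y0, hy0⟩ := hD2.nonempty
  rcases hy0 with hy0 | hy0
  · obtain ⟨L, hL⟩ := exists_cyl hU2 hy0
    refine ⟨L, fun L' hL' x hx x' hx' hag => ?_⟩
    refine dep_aux (fun a b => a && b) false (by simp) (by simp) hU1 hV1 hD4 y0 L ?_ hx hx'
      (fun i hi => hag i (by omega))
    intro x y hy
    exact ⟨fun h => c4 x y h (hL y hy), fun h => c5 x y h⟩
  · obtain ⟨L, hL⟩ := exists_cyl hV2 hy0
    refine ⟨L, fun L' hL' x hx x' hx' hag => ?_⟩
    refine dep_aux (fun a b => a || b) true (by simp) (by simp) hU1 hV1 hD3 y0 L ?_ hx hx'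
      (fun i hi => hag i (by omega))
    intro x y hy
    exact ⟨fun h => c1 x y h, fun h => c3 x y h (hL y hy)⟩

lemma finite_atom (L : ℕ) (g1 g2 : (ℕ → Bool) → Prop)
    (hg1 : ∀ x x' : ℕ → Bool, (∀ i < L, x i = x' i) → (g1 x ↔ g1 x'))
    (hor : ∀ x y : ℕ → Bool, (g1 x ∨ g2 y) ↔
      (g1 (fun i => x i || y i) ∨ g2 (fun i => x i || y i)))
    (hand : ∀ x y : ℕ → Bool, (g1 x ∧ g2 y) ↔
      (g1 (fun i => x i && y i) ∧ g2 (fun i => x i && y i)))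
    (ht : ∃ x, g1 x) (hf : ∃ x, ¬ g1 x) : ∃ e, ∀ x, g1 x ↔ x e = true := by
  obtain ⟨x1, hx1⟩ := ht
  obtain ⟨x0, hx0⟩ := hf
  set one : ℕ → Bool := fun _ => true with hone
  set zer : ℕ → Bool := fun _ => false with hzer
  have o1 : ∀ x y, (g1 x ∨ g2 y) → (g1 one ∨ g2 one) := by
    intro x y h
    have a1 := (hor x one); have a2 := hor one y; have a3 := hor one one
    simp [hone] at a1 a2 a3 ⊢
    rw [← hone] at *
    rcases h with h | h
    · exact a1.1 (Or.inl h)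
    · exact a2.1 (Or.inr h)
  have z1 : ∀ x y, (g1 zer ∧ g2 zer) → (g1 x ∧ g2 y) := by
    intro x y h
    have a1 := (hand x zer); have a2 := hand zer y
    simp only [hzer, Bool.and_false, Bool.false_and] at a1 a2
    rw [← hzer] at *
    have b1 := a1.2 h; have b2 := a2.2 h
    exact ⟨b1.1, b2.2⟩
  have hone' := o1 x1 x1 (Or.inl hx1)
  have hzer' : ¬ (g1 zer ∧ g2 zer) := fun h => hx0 (z1 x0 x0 h).1
  have ao : ∀ x, g1 x ∨ g2 one := fun x => by
    have := (hor x one); simp [hone] at this; rw [← hone] at *; exact this.2 hone'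
  have ao' : ∀ y, g1 one ∨ g2 y := fun x => by
    have := (hor one x); simp [hone] at this; rw [← hone] at *; exact this.2 hone'
  have az : ∀ x, ¬ (g1 x ∧ g2 zer) := fun x => by
    have := (hand x zer); simp only [hzer, Bool.and_false] at this; rw [← hzer] at *
    exact fun h => hzer' (this.1 h)
  have az' : ∀ x, ¬ (g1 zer ∧ g2 x) := fun x => by
    have := (hand zer x); simp only [hzer, Bool.false_and] at this; rw [← hzer] at *
    exact fun h => hzer' (this.1 h)
  have g2one : g2 one := (ao x0).resolve_left hx0
  have g2zer : ¬ g2 zer := fun h => az x1 ⟨hx1, h⟩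
  have g1one : g1 one := (ao' zer).resolve_right g2zer
  have g1zer : ¬ g1 zer := fun h => az' one ⟨h, g2one⟩
  have e12 : ∀ x, g1 x ↔ g2 x := by
    intro x
    have a1 := hor x zer; have a2 := hor zer x
    simp only [hzer, Bool.or_false, Bool.false_or] at a1 a2
    rw [← hzer] at *
    tauto
  have hor' : ∀ x y : ℕ → Bool, g1 (fun i => x i || y i) ↔ (g1 x ∨ g1 y) := by
    intro x y; have := hor x y; rw [← e12, ← e12] at this; tauto
  have hand' : ∀ x y : ℕ → Bool, g1 (fun i => x i && y i) ↔ (g1 x ∧ g1 y) := by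
    intro x y; have := hand x y; rw [← e12, ← e12] at this; tauto
  let δ : ℕ → ℕ → Bool := fun e i => decide (i = e)
  have hex : ∃ e, g1 (δ e) := by
    by_contra hno
    push Not at hno
    have hl : ∀ l : ℕ, ¬ g1 (fun i => decide (i < l)) := by
      intro l
      induction l with
      | zero => simpa using g1zer
      | succ l ih =>
        have : (fun i => decide (i < l + 1)) = (fun i => (decide (i < l)) || δ l i) := by
          funext i
          simp only [δ]
          rw [← Bool.decide_or]
          congr 1
          apply propext; omega
        rw [this, hor']
        rintro (h | h)
        · exact ih h
        · exact hno l h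
    exact hl L ((hg1 _ _ (fun i hi => by simp [hone, hi])).1 g1one)
  obtain ⟨e, he⟩ := hex
  refine ⟨e, fun x => ⟨fun hx => ?_, fun hx => ?_⟩⟩
  · by_contra hxe
    have h := (hand' x (δ e)).2 ⟨hx, he⟩
    apply g1zer
    convert h using 1
    funext i
    by_cases hi : i = e
    · subst hi; simp [hzer, hxe]
    · simp [hzer, δ, hi]
  · have h := (hor' x (δ e)).2 (Or.inr he)
    convert h using 1
    funext i
    by_cases hi : i = e
    · subst hi; simp [hx]
    · simp [δ, hi]

lemma prop_uv {g u v : Prop} (a : u → g) (b : v → ¬ g) (c : u ∨ v) :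
    (g ↔ u) ∧ (¬ g ↔ v) := by tauto

lemma prop_or {g1 g2 h1 h2 u1 v1 u2 v2 s1 t1 s2 t2 u3 v3 : Prop}
    (a1 : (g1 ↔ u1) ∧ (¬ g1 ↔ v1)) (a2 : (g2 ↔ u2) ∧ (¬ g2 ↔ v2))
    (a3 : (h1 ↔ s1) ∧ (¬ h1 ↔ t1)) (a4 : (h2 ↔ s2) ∧ (¬ h2 ↔ t2))
    (b1 : u1 → ¬ v3) (b2 : u2 → ¬ v3) (b3 : v1 → v2 → ¬ u3)
    (d1 : s1 → ¬ v3) (d2 : s2 → ¬ v3) (d3 : t1 → t2 → ¬ u3) (dd : u3 ∨ v3) :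
    (g1 ∨ g2) ↔ (h1 ∨ h2) := by grind

lemma prop_and {g1 g2 h1 h2 u1 v1 u2 v2 s1 t1 s2 t2 u3 v3 : Prop}
    (a1 : (g1 ↔ u1) ∧ (¬ g1 ↔ v1)) (a2 : (g2 ↔ u2) ∧ (¬ g2 ↔ v2))
    (a3 : (h1 ↔ s1) ∧ (¬ h1 ↔ t1)) (a4 : (h2 ↔ s2) ∧ (¬ h2 ↔ t2))
    (b1 : u1 → u2 → ¬ v3) (b2 : v1 → ¬ u3) (b3 : v2 → ¬ u3)
    (d1 : s1 → s2 → ¬ v3) (d2 : t1 → ¬ u3) (d3 : t2 → ¬ u3) (dd : u3 ∨ v3) :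
    (g1 ∧ g2) ↔ (h1 ∧ h2) := by grind

lemma atom {U1 V1 U2 V2 U3 V3 U4 V4 : Set (ℕ → Bool)}
    (hU1 : IsOpen U1) (hV1 : IsOpen V1) (hU2 : IsOpen U2) (hV2 : IsOpen V2)
    (hU3 : IsOpen U3) (hV3 : IsOpen V3) (hU4 : IsOpen U4) (hV4 : IsOpen V4)
    (hD1 : Dense (U1 ∪ V1)) (hD2 : Dense (U2 ∪ V2))
    (hD3 : Dense (U3 ∪ V3)) (hD4 : Dense (U4 ∪ V4))
    (c1 : ∀ x y : ℕ → Bool, x ∈ U1 → (fun i => x i || y i) ∉ V3)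
    (c2 : ∀ x y : ℕ → Bool, y ∈ U2 → (fun i => x i || y i) ∉ V3)
    (c3 : ∀ x y : ℕ → Bool, x ∈ V1 → y ∈ V2 → (fun i => x i || y i) ∉ U3)
    (c4 : ∀ x y : ℕ → Bool, x ∈ U1 → y ∈ U2 → (fun i => x i && y i) ∉ V4)
    (c5 : ∀ x y : ℕ → Bool, x ∈ V1 → (fun i => x i && y i) ∉ U4)
    (c6 : ∀ x y : ℕ → Bool, y ∈ V2 → (fun i => x i && y i) ∉ U4) :
    U1 = ∅ ∨ V1 = ∅ ∨ ∃ e : ℕ, (∀ x ∈ U1, x e = true) ∧ (∀ x ∈ V1, x e = false) := by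
  obtain ⟨La, hLa⟩ := dep_all hU1 hV1 hU2 hV2 hD2 hD3 hD4 c1 c3 c4 c5
  obtain ⟨Lb, hLb⟩ := dep_all (U1 := U2) (V1 := V2) (U2 := U1) (V2 := V1) hU2 hV2 hU1 hV1 hD1 hD3 hD4
    (fun x y h => by simpa [Bool.or_comm] using c2 y x h)
    (fun x y h h' => by simpa [Bool.or_comm] using c3 y x h' h)
    (fun x y h h' => by simpa [Bool.and_comm] using c4 y x h' h)
    (fun x y h => by simpa [Bool.and_comm] using c6 y x h)
  set L := La + Lb
  replace hLa := hLa L (by omega)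
  replace hLb := hLb L (by omega)
  by_cases e1 : U1 = ∅
  · exact Or.inl e1
  by_cases e2 : V1 = ∅
  · exact Or.inr (Or.inl e2)
  right; right
  obtain ⟨u, hu⟩ := Set.nonempty_iff_ne_empty.2 e1
  obtain ⟨v, hv⟩ := Set.nonempty_iff_ne_empty.2 e2
  let g1 : (ℕ → Bool) → Prop := fun x => ∃ x' ∈ U1, ∀ i < L, x i = x' i
  let g2 : (ℕ → Bool) → Prop := fun x => ∃ x' ∈ U2, ∀ i < L, x i = x' i
  have g1U : ∀ x ∈ U1, g1 x := fun x hx => ⟨x, hx, fun _ _ => rfl⟩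
  have g2U : ∀ x ∈ U2, g2 x := fun x hx => ⟨x, hx, fun _ _ => rfl⟩
  have g1V : ∀ x ∈ V1, ¬ g1 x := fun x hx ⟨x', h1, h2⟩ => hLa x' h1 x hx (fun i hi => (h2 i hi).symm)
  have g2V : ∀ x ∈ V2, ¬ g2 x := fun x hx ⟨x', h1, h2⟩ => hLb x' h1 x hx (fun i hi => (h2 i hi).symm)
  have inv1 : ∀ x x' : ℕ → Bool, (∀ i < L, x i = x' i) → (g1 x ↔ g1 x') := by
    intro x x' h
    constructor
    · rintro ⟨z, hz, hz'⟩; exact ⟨z, hz, fun i hi => (h i hi).symm.trans (hz' i hi)⟩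
    · rintro ⟨z, hz, hz'⟩; exact ⟨z, hz, fun i hi => (h i hi).trans (hz' i hi)⟩
  have inv2 : ∀ x x' : ℕ → Bool, (∀ i < L, x i = x' i) → (g2 x ↔ g2 x') := by
    intro x x' h
    constructor
    · rintro ⟨z, hz, hz'⟩; exact ⟨z, hz, fun i hi => (h i hi).symm.trans (hz' i hi)⟩
    · rintro ⟨z, hz, hz'⟩; exact ⟨z, hz, fun i hi => (h i hi).trans (hz' i hi)⟩
  let D : Set (ℕ → Bool) := (U1 ∪ V1) ∩ (U2 ∪ V2) ∩ (U3 ∪ V3) ∩ (U4 ∪ V4)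
  have o1 := hU1.union hV1
  have o2 := hU2.union hV2
  have o3 := hU3.union hV3
  have o4 := hU4.union hV4
  have hDo : IsOpen D := ((o1.inter o2).inter o3).inter o4
  have hDd : Dense D := ((hD1.inter_of_isOpen_right hD2 o2).inter_of_isOpen_right hD3 o3).inter_of_isOpen_right hD4 o4
  have key : ∀ x y : ℕ → Bool, ∃ x' y' : ℕ → Bool, (∀ i < L, x i = x' i) ∧ (∀ i < L, y i = y' i) ∧
      x' ∈ D ∧ y' ∈ D ∧ (fun i => x' i || y' i) ∈ D ∧ (fun i => x' i && y' i) ∈ D := by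
    intro x y
    have pre : ∀ h : Bool × Bool → Bool, Function.Surjective h →
        IsOpen ((fun (p : ℕ → Bool × Bool) i => h (p i)) ⁻¹' D) ∧
        Dense ((fun (p : ℕ → Bool × Bool) i => h (p i)) ⁻¹' D) := by
      intro h hs
      exact ⟨hDo.preimage (continuous_pm fun _ => h),
        hDd.preimage (isOpenMap_pm (fun _ => h) ⟨0, fun _ _ => hs⟩)⟩
    have h1 := pre _ surj_fst
    have h2 := pre _ surj_snd
    have h3 := pre _ surj_or
    have h4 := pre _ surj_and
    have hd := ((h1.2.inter_of_isOpen_right h2.2 h2.1).inter_of_isOpen_right h3.2 h3.1).inter_of_isOpen_right h4.2 h4.1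
    obtain ⟨p, hp, hpL⟩ := dense_cyl hd (fun i => (x i, y i)) L
    refine ⟨fun i => (p i).1, fun i => (p i).2, fun i hi => by simp [hpL i hi], fun i hi => by simp [hpL i hi],
      hp.1.1.1, hp.1.1.2, hp.1.2, hp.2⟩
  have hg1 : ∀ x ∈ D, (g1 x ↔ x ∈ U1) ∧ (¬ g1 x ↔ x ∈ V1) := by
    intro x hx
    have a := g1U x; have b := g1V x; have c : x ∈ U1 ∪ V1 := hx.1.1.1
    simp only [Set.mem_union] at c
    exact prop_uv a b c
  have hg2 : ∀ x ∈ D, (g2 x ↔ x ∈ U2) ∧ (¬ g2 x ↔ x ∈ V2) := by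
    intro x hx
    have a := g2U x; have b := g2V x; have c : x ∈ U2 ∪ V2 := hx.1.1.2
    simp only [Set.mem_union] at c
    exact prop_uv a b c
  obtain ⟨e, he⟩ := finite_atom L g1 g2 inv1 (by
      intro x y
      obtain ⟨x', y', hx, hy, dx, dy, dv, -⟩ := key x y
      rw [inv1 x x' hx, inv2 y y' hy,
        inv1 (fun i => x i || y i) (fun i => x' i || y' i) (fun i hi => by simp [hx i hi, hy i hi]),
        inv2 (fun i => x i || y i) (fun i => x' i || y' i) (fun i hi => by simp [hx i hi, hy i hi])]
      have a1 := hg1 _ dx; have a2 := hg2 _ dy; have a3 := hg1 _ dv; have a4 := hg2 _ dv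
      have b1 := c1 x' y'; have b2 := c2 x' y'; have b3 := c3 x' y'
      have hself : (fun i => (x' i || y' i) || (x' i || y' i)) = (fun i => x' i || y' i) := by
        funext i; simp
      have d1 := c1 (fun i => x' i || y' i) (fun i => x' i || y' i)
      have d2 := c2 (fun i => x' i || y' i) (fun i => x' i || y' i)
      have d3 := c3 (fun i => x' i || y' i) (fun i => x' i || y' i)
      rw [hself] at d1 d2 d3
      have dd := dv.1.2
      exact prop_or a1 a2 a3 a4 b1 b2 b3 d1 d2 d3 dd) (by
      intro x y
      obtain ⟨x', y', hx, hy, dx, dy, -, dv⟩ := key x y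
      rw [inv1 x x' hx, inv2 y y' hy,
        inv1 (fun i => x i && y i) (fun i => x' i && y' i) (fun i hi => by simp [hx i hi, hy i hi]),
        inv2 (fun i => x i && y i) (fun i => x' i && y' i) (fun i hi => by simp [hx i hi, hy i hi])]
      have a1 := hg1 _ dx; have a2 := hg2 _ dy; have a3 := hg1 _ dv; have a4 := hg2 _ dv
      have b1 := c4 x' y'; have b2 := c5 x' y'; have b3 := c6 x' y'
      have hself : (fun i => (x' i && y' i) && (x' i && y' i)) = (fun i => x' i && y' i) := by
        funext i; simp
      have d1 := c4 (fun i => x' i && y' i) (fun i => x' i && y' i)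
      have d2 := c5 (fun i => x' i && y' i) (fun i => x' i && y' i)
      have d3 := c6 (fun i => x' i && y' i) (fun i => x' i && y' i)
      rw [hself] at d1 d2 d3
      have dd := dv.2
      exact prop_and a1 a2 a3 a4 b1 b2 b3 d1 d2 d3 dd) ⟨u, g1U u hu⟩ ⟨v, g1V v hv⟩
  refine ⟨e, fun x hx => (he x).1 (g1U x hx), fun x hx => ?_⟩
  have := g1V x hx
  rw [he] at this
  simpa using this




/-- almost equality of sets of naturals -/
def AEq (X Y : Set ℕ) : Prop := ∀ᶠ j in atTop, (j ∈ X ↔ j ∈ Y)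

/-- overwrite the first `k` coordinates -/
def ovr {α : Type*} (k : ℕ) (z x : ℕ → α) : ℕ → α := fun i => if i < k then z i else x i

lemma continuous_ovr {α : Type*} [TopologicalSpace α] [DiscreteTopology α] (k : ℕ) (z : ℕ → α) :
    Continuous (ovr k z) :=
  continuous_pm (fun i (b : α) => if i < k then z i else b)

lemma isOpenMap_ovr {α : Type*} [TopologicalSpace α] [DiscreteTopology α] (k : ℕ) (z : ℕ → α) :
    IsOpenMap (ovr k z) :=
  isOpenMap_pm (fun i (b : α) => if i < k then z i else b)
    ⟨k, fun i hi b => ⟨b, by simp [not_lt.2 hi]⟩⟩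

lemma resid_comp {X Y : Type*} [TopologicalSpace X] [TopologicalSpace Y] {g : X → Y}
    (hc : Continuous g) (ho : IsOpenMap g) {p : Y → Prop} (h : ∀ᶠ y in residual Y, p y) :
    ∀ᶠ x in residual X, p (g x) :=
  (tendsto_residual_of_isOpenMap hc ho).eventually h

lemma baire_cover {X : Type*} [TopologicalSpace X] [BaireSpace X] [Nonempty X] {ι : Type*}
    [Countable ι] {C : ι → Set X} (hC : ∀ i, IsClosed (C i))
    (h : ∀ᶠ x in residual X, ∃ i, x ∈ C i) : ∃ i, (interior (C i)).Nonempty := by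
  obtain ⟨t, ht, hG, hd⟩ := mem_residual.1 h
  have := hG.dense_iUnion_interior_of_closed hd hC (fun x hx => by simpa using ht hx)
  obtain ⟨x, hx⟩ := this.nonempty
  obtain ⟨i, hi⟩ := Set.mem_iUnion.1 hx
  exact ⟨i, x, hi⟩

lemma prop_conf {t1 t2 t3 t4 u1 u2 u3 u4 v1 v2 v3 v4 : Prop} (h1 : t1 ↔ u1) (h2 : t2 ↔ u2)
    (h3 : t3 ↔ u3) (h4 : t4 ↔ u4) (h5 : t3 ↔ t1 ∨ t2) (h6 : t4 ↔ t1 ∧ t2)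
    (d1 : u1 → ¬ v1) (d2 : u2 → ¬ v2) (d3 : u3 → ¬ v3) (d4 : u4 → ¬ v4) :
    ¬ ((((((u1 ∧ v3) ∨ (u2 ∧ v3)) ∨ ((v1 ∧ v2) ∧ u3)) ∨ ((u1 ∧ u2) ∧ v4)) ∨
      (v1 ∧ u4)) ∨ (v2 ∧ u4)) := by
  grind

lemma ca_core (Θ : (ℕ → Bool) → Set ℕ)
    (hor : ∀ x y, AEq (Θ fun i => x i || y i) (Θ x ∪ Θ y))
    (hand : ∀ x y, AEq (Θ fun i => x i && y i) (Θ x ∩ Θ y))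
    (U V : ℕ → Set (ℕ → Bool)) (hU : ∀ j, IsOpen (U j)) (hV : ∀ j, IsOpen (V j))
    (hdis : ∀ j x, x ∈ U j → x ∉ V j)
    (hcov : ∀ᶠ x in residual (ℕ → Bool), ∀ j, x ∈ U j ∪ V j)
    (hΘ : ∀ᶠ x in residual (ℕ → Bool), AEq (Θ x) {j | x ∈ U j}) :
    ∃ (k : ℕ) (σ : ℕ → Bool) (K : ℕ → Set ℕ) (P : Set ℕ),
      (∀ e e', e ≠ e' → Disjoint (K e) (K e')) ∧
      ∀ᶠ x in residual (ℕ → Bool),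
        AEq (Θ (ovr k σ x)) (P ∪ {j | ∃ e, x e = true ∧ j ∈ K e}) := by
  let f1 : (ℕ → Bool × Bool) → ℕ → Bool := fun p i => (p i).1
  let f2 : (ℕ → Bool × Bool) → ℕ → Bool := fun p i => (p i).2
  let f3 : (ℕ → Bool × Bool) → ℕ → Bool := fun p i => (p i).1 || (p i).2
  let f4 : (ℕ → Bool × Bool) → ℕ → Bool := fun p i => (p i).1 && (p i).2
  have k1 : Continuous f1 := continuous_pm (fun _ (p : Bool × Bool) => p.1)
  have k2 : Continuous f2 := continuous_pm (fun _ (p : Bool × Bool) => p.2)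
  have k3 : Continuous f3 := continuous_pm (fun _ (p : Bool × Bool) => p.1 || p.2)
  have k4 : Continuous f4 := continuous_pm (fun _ (p : Bool × Bool) => p.1 && p.2)
  have m1 : IsOpenMap f1 := isOpenMap_pm (fun _ (p : Bool × Bool) => p.1) ⟨0, fun _ _ => surj_fst⟩
  have m2 : IsOpenMap f2 := isOpenMap_pm (fun _ (p : Bool × Bool) => p.2) ⟨0, fun _ _ => surj_snd⟩
  have m3 : IsOpenMap f3 :=
    isOpenMap_pm (fun _ (p : Bool × Bool) => p.1 || p.2) ⟨0, fun _ _ => surj_or⟩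
  have m4 : IsOpenMap f4 :=
    isOpenMap_pm (fun _ (p : Bool × Bool) => p.1 && p.2) ⟨0, fun _ _ => surj_and⟩
  let bad : ℕ → Set (ℕ → Bool × Bool) := fun j =>
    (f1 ⁻¹' U j ∩ f3 ⁻¹' V j) ∪ (f2 ⁻¹' U j ∩ f3 ⁻¹' V j) ∪
    (f1 ⁻¹' V j ∩ f2 ⁻¹' V j ∩ f3 ⁻¹' U j) ∪
    (f1 ⁻¹' U j ∩ f2 ⁻¹' U j ∩ f4 ⁻¹' V j) ∪
    (f1 ⁻¹' V j ∩ f4 ⁻¹' U j) ∪ (f2 ⁻¹' V j ∩ f4 ⁻¹' U j)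
  have hbad : ∀ j, IsOpen (bad j) := by
    intro j
    have a1 := (hU j).preimage k1
    have a2 := (hU j).preimage k2
    have a3 := (hU j).preimage k3
    have a4 := (hU j).preimage k4
    have b1 := (hV j).preimage k1
    have b2 := (hV j).preimage k2
    have b3 := (hV j).preimage k3
    have b4 := (hV j).preimage k4
    exact (((((a1.inter b3).union (a2.inter b3)).union ((b1.inter b2).inter a3)).union
      ((a1.inter a2).inter b4)).union (b1.inter a4)).union (b2.inter a4)
  obtain ⟨m, w, hw⟩ := baire_cover (C := fun m : ℕ => ⋂ j ≥ m, (bad j)ᶜ)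
    (fun m => isClosed_biInter fun j _ => (hbad j).isClosed_compl) (by
      filter_upwards [resid_comp k1 m1 hΘ, resid_comp k2 m2 hΘ, resid_comp k3 m3 hΘ,
        resid_comp k4 m4 hΘ] with w h1 h2 h3 h4
      have h5 := hor (f1 w) (f2 w)
      have h6 := hand (f1 w) (f2 w)
      have : ∀ᶠ j in atTop, w ∉ bad j := by
        filter_upwards [h1, h2, h3, h4, h5, h6] with j h1 h2 h3 h4 h5 h6
        have d1 := hdis j (f1 w); have d2 := hdis j (f2 w)
        have d3 := hdis j (f3 w); have d4 := hdis j (f4 w)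
        change _ ∈ Θ (f3 w) ↔ _ at h5
        change _ ∈ Θ (f4 w) ↔ _ at h6
        exact fun hb => prop_conf h1 h2 h3 h4 h5 h6 d1 d2 d3 d4 hb
      obtain ⟨m, hm⟩ := eventually_atTop.1 this
      exact ⟨m, by simpa using hm⟩)
  obtain ⟨k, hk⟩ := exists_cyl isOpen_interior hw
  have hk' : ∀ x y : ℕ → Bool, ∀ j ≥ m,
      (fun i => (ovr k (f1 w) x i, ovr k (f2 w) y i)) ∉ bad j := by
    intro x y j hj
    have := interior_subset (hk (fun i => (ovr k (f1 w) x i, ovr k (f2 w) y i))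
      (fun i hi => by simp [ovr, hi, f1, f2]))
    simp only [mem_iInter] at this
    exact this j hj
  have e3 : ∀ x y : ℕ → Bool, f3 (fun i => (ovr k (f1 w) x i, ovr k (f2 w) y i)) =
      ovr k (f3 w) (fun i => x i || y i) := by
    intro x y; funext i; by_cases h : i < k <;> simp [f3, ovr, h, f1, f2]
  have e4 : ∀ x y : ℕ → Bool, f4 (fun i => (ovr k (f1 w) x i, ovr k (f2 w) y i)) =
      ovr k (f4 w) (fun i => x i && y i) := by
    intro x y; funext i; by_cases h : i < k <;> simp [f4, ovr, h, f1, f2]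
  have hden : ∀ (σ : ℕ → Bool) j, Dense (ovr k σ ⁻¹' U j ∪ ovr k σ ⁻¹' V j) := by
    intro σ j
    apply dense_of_mem_residual
    filter_upwards [resid_comp (continuous_ovr k σ) (isOpenMap_ovr k σ) hcov] with x hx
    exact hx j
  have tri : ∀ j ≥ m, ovr k (f1 w) ⁻¹' U j = ∅ ∨ ovr k (f1 w) ⁻¹' V j = ∅ ∨
      ∃ e : ℕ, (∀ x ∈ ovr k (f1 w) ⁻¹' U j, x e = true) ∧
        (∀ x ∈ ovr k (f1 w) ⁻¹' V j, x e = false) := by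
    intro j hj
    have cc := fun x y => hk' x y j hj
    simp only [bad, mem_union, mem_inter_iff, mem_preimage, e3, e4] at cc
    refine atom (U2 := ovr k (f2 w) ⁻¹' U j) (V2 := ovr k (f2 w) ⁻¹' V j)
      (U3 := ovr k (f3 w) ⁻¹' U j) (V3 := ovr k (f3 w) ⁻¹' V j)
      (U4 := ovr k (f4 w) ⁻¹' U j) (V4 := ovr k (f4 w) ⁻¹' V j)
      ((hU j).preimage (continuous_ovr _ _)) ((hV j).preimage (continuous_ovr _ _))
      ((hU j).preimage (continuous_ovr _ _)) ((hV j).preimage (continuous_ovr _ _))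
      ((hU j).preimage (continuous_ovr _ _)) ((hV j).preimage (continuous_ovr _ _))
      ((hU j).preimage (continuous_ovr _ _)) ((hV j).preimage (continuous_ovr _ _))
      (hden _ _) (hden _ _) (hden _ _) (hden _ _) ?_ ?_ ?_ ?_ ?_ ?_
    · intro x y h h'; exact cc x y (Or.inl (Or.inl (Or.inl (Or.inl (Or.inl ⟨h, h'⟩)))))
    · intro x y h h'; exact cc x y (Or.inl (Or.inl (Or.inl (Or.inl (Or.inr ⟨h, h'⟩)))))
    · intro x y h h' h2; exact cc x y (Or.inl (Or.inl (Or.inl (Or.inr ⟨⟨h, h'⟩, h2⟩))))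
    · intro x y h h' h2; exact cc x y (Or.inl (Or.inl (Or.inr ⟨⟨h, h'⟩, h2⟩)))
    · intro x y h h'; exact cc x y (Or.inl (Or.inr ⟨h, h'⟩))
    · intro x y h h'; exact cc x y (Or.inr ⟨h, h'⟩)
  have tri' : ∀ j, ∃ e : ℕ, m ≤ j → (ovr k (f1 w) ⁻¹' U j).Nonempty →
      (ovr k (f1 w) ⁻¹' V j).Nonempty → (∀ x ∈ ovr k (f1 w) ⁻¹' U j, x e = true) ∧
        (∀ x ∈ ovr k (f1 w) ⁻¹' V j, x e = false) := by
    intro j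
    by_cases hj : m ≤ j
    · rcases tri j hj with h | h | ⟨e, he⟩
      · exact ⟨0, fun _ h' => absurd h h'.ne_empty⟩
      · exact ⟨0, fun _ _ h' => absurd h h'.ne_empty⟩
      · exact ⟨e, fun _ _ _ => he⟩
    · exact ⟨0, fun h => absurd h hj⟩
  choose ε hε using tri'
  refine ⟨k, f1 w, fun e => {j | (ovr k (f1 w) ⁻¹' U j).Nonempty ∧
      (ovr k (f1 w) ⁻¹' V j).Nonempty ∧ ε j = e},
    {j | (ovr k (f1 w) ⁻¹' U j).Nonempty ∧ ¬ (ovr k (f1 w) ⁻¹' V j).Nonempty}, ?_, ?_⟩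
  · intro e e' hne
    rw [Set.disjoint_left]
    rintro j ⟨-, -, h1⟩ ⟨-, -, h2⟩
    exact hne (h1.symm.trans h2)
  · have q1 := resid_comp (continuous_ovr k (f1 w)) (isOpenMap_ovr k (f1 w)) hcov
    have q2 := resid_comp (continuous_ovr k (f1 w)) (isOpenMap_ovr k (f1 w)) hΘ
    filter_upwards [q1, q2] with x h1 h2
    filter_upwards [h2, eventually_ge_atTop m] with j h2 hj
    rw [h2]
    simp only [mem_ofPred_eq, mem_union]
    constructor
    · intro hx
      by_cases hne : (ovr k (f1 w) ⁻¹' V j).Nonempty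
      · right
        exact ⟨ε j, (hε j hj ⟨x, hx⟩ hne).1 x hx, ⟨x, hx⟩, hne, rfl⟩
      · exact Or.inl ⟨⟨x, hx⟩, hne⟩
    · rintro (⟨ha, hb⟩ | ⟨e, he, ha, hb, rfl⟩)
      · rcases h1 j with h | h
        · exact h
        · exact absurd ⟨x, h⟩ hb
      · rcases h1 j with h | h
        · exact h
        · have := (hε j hj ha hb).2 x h
          simp [he] at this

lemma ca_lemma (Θ : (ℕ → Bool) → Set ℕ)
    (hor : ∀ x y, AEq (Θ fun i => x i || y i) (Θ x ∪ Θ y))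
    (hand : ∀ x y, AEq (Θ fun i => x i && y i) (Θ x ∩ Θ y))
    (hdiff : ∀ x y, AEq (Θ fun i => x i && !y i) (Θ x \ Θ y))
    (U V : ℕ → Set (ℕ → Bool)) (hU : ∀ j, IsOpen (U j)) (hV : ∀ j, IsOpen (V j))
    (N : Set (ℕ → Bool)) (hN : IsOpen N) (hNe : N.Nonempty)
    (hdis : ∀ j, ∀ x ∈ N, x ∈ U j → x ∉ V j)
    (hcov : ∀ᶠ x in residual (ℕ → Bool), x ∈ N → ∀ j, x ∈ U j ∪ V j)
    (hΘ : ∀ᶠ x in residual (ℕ → Bool), x ∈ N → AEq (Θ x) {j | x ∈ U j}) :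
    ∃ (k : ℕ) (K : ℕ → Set ℕ), (∀ e e', e ≠ e' → Disjoint (K e) (K e')) ∧
      ∀ x : ℕ → Bool, (∀ i < k, x i = false) → AEq (Θ x) {j | ∃ e, x e = true ∧ j ∈ K e} := by
  obtain ⟨z, hz⟩ := hNe
  obtain ⟨k0, hk0⟩ := exists_cyl hN hz
  have inN : ∀ x, ovr k0 z x ∈ N := fun x => hk0 _ fun i hi => by simp [ovr, hi]
  obtain ⟨k, σ, K, P, hK, hres⟩ := ca_core (fun x => Θ (ovr k0 z x)) (fun x y => by
      have := hor (ovr k0 z x) (ovr k0 z y)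
      convert this using 2
      funext i; by_cases h : i < k0 <;> simp [ovr, h]) (fun x y => by
      have := hand (ovr k0 z x) (ovr k0 z y)
      convert this using 2
      funext i; by_cases h : i < k0 <;> simp [ovr, h])
    (fun j => ovr k0 z ⁻¹' U j) (fun j => ovr k0 z ⁻¹' V j)
    (fun j => (hU j).preimage (continuous_ovr _ _)) (fun j => (hV j).preimage (continuous_ovr _ _))
    (fun j x h => hdis j _ (inN x) h)
    (by
      filter_upwards [resid_comp (continuous_ovr k0 z) (isOpenMap_ovr k0 z) hcov] with x hx
      exact hx (inN x))
    (by
      filter_upwards [resid_comp (continuous_ovr k0 z) (isOpenMap_ovr k0 z) hΘ] with x hx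
      exact hx (inN x))
  refine ⟨max k k0, fun e => K e \ P, fun e e' h => (hK e e' h).mono sdiff_le sdiff_le, ?_⟩
  intro X hX
  have c : Continuous (fun (y : ℕ → Bool) i => xor (y i) (X i)) :=
    continuous_pm (fun i b => xor b (X i))
  have o : IsOpenMap (fun (y : ℕ → Bool) i => xor (y i) (X i)) :=
    isOpenMap_pm (fun i b => xor b (X i)) ⟨0, fun i _ b => ⟨xor b (X i), by simp⟩⟩
  obtain ⟨y, hy1, hy2⟩ := (dense_of_mem_residual (inter_mem hres (resid_comp c o hres))).nonempty
  set y1 := ovr k0 z (ovr k σ y)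
  set y2 := ovr k0 z (ovr k σ (fun i => xor (y i) (X i)))
  have e1 : X = fun i => (y1 i && !y2 i) || (y2 i && !y1 i) := by
    funext i
    by_cases h : i < k0
    · simp [y1, y2, ovr, h, hX i (by omega)]
    · by_cases h' : i < k
      · simp [y1, y2, ovr, h, h', hX i (by omega)]
      · simp [y1, y2, ovr, h, h']
        cases y i <;> cases X i <;> rfl
  have a1 := hor (fun i => y1 i && !y2 i) (fun i => y2 i && !y1 i)
  rw [← e1] at a1
  filter_upwards [a1, hdiff y1 y2, hdiff y2 y1, hy1, hy2] with j a1 a2 a3 a4 a5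
  change j ∈ Θ y1 ↔ _ at a4
  change j ∈ Θ y2 ↔ _ at a5
  simp only [mem_union, Set.mem_sdiff, a2, a3, a4, a5, mem_ofPred_eq] at a1 ⊢
  rw [a1]
  constructor
  · rintro (⟨h1 | ⟨e, h1, h2⟩, h3⟩ | ⟨h1 | ⟨e, h1, h2⟩, h3⟩)
    · exact absurd (Or.inl h1) h3
    · push Not at h3
      refine ⟨e, ?_, h2, h3.1⟩
      by_contra hx
      exact h3.2 e (by simp [h1, hx]) h2
    · exact absurd (Or.inl h1) h3
    · push Not at h3
      refine ⟨e, ?_, h2, h3.1⟩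
      by_contra hx
      exact h3.2 e (by simpa [hx] using h1) h2
  · rintro ⟨e, h1, h2, h3⟩
    have uniq : ∀ e', j ∈ K e' → e' = e := by
      intro e' he'
      by_contra hne
      exact Set.disjoint_left.1 (hK e' e hne) he' h2
    cases hye : y e with
    | true =>
      left
      refine ⟨Or.inr ⟨e, hye, h2⟩, ?_⟩
      rintro (h | ⟨e', h4, h5⟩)
      · exact h3 h
      · obtain rfl := uniq e' h5
        simp [hye, h1] at h4
    | false =>
      right
      refine ⟨Or.inr ⟨e, by simp [hye, h1], h2⟩, ?_⟩
      rintro (h | ⟨e', h4, h5⟩)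
      · exact h3 h
      · obtain rfl := uniq e' h5
        simp [hye] at h4




/-- prepend an element to a sequence -/
def cns {K : Type*} (x : K) (R : ℕ → K) : ℕ → K
  | 0 => x
  | k + 1 => R k

/-- put a sequence behind an initial segment of length `n` -/
def glu {K : Type*} (n : ℕ) (p R : ℕ → K) : ℕ → K := fun k => if k < n then p k else R (k - n)

lemma cns_shift {K : Type*} (y : ℕ → K) : cns (y 0) (fun k => y (k + 1)) = y := by
  funext k; cases k <;> rfl

lemma continuous_cns {K : Type*} [TopologicalSpace K] :
    Continuous (fun q : K × (ℕ → K) => cns q.1 q.2) := by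
  refine continuous_pi fun k => ?_
  cases k with
  | zero => exact continuous_fst
  | succ k => exact (continuous_apply k).comp continuous_snd

lemma continuous_glu {K : Type*} [TopologicalSpace K] (n : ℕ) (p : ℕ → K) :
    Continuous (glu n p) := by
  refine continuous_pi fun k => ?_
  by_cases h : k < n
  · simpa [glu, h] using continuous_const
  · simpa [glu, h] using continuous_apply (k - n)

/-- easy half of Kuratowski-Ulam -/
lemma ku {K : Type*} [TopologicalSpace K] [SecondCountableTopology K]
    {G : Set (ℕ → K)} (hG : IsOpen G) (hd : Dense G) :
    ∀ᶠ x in residual K, Dense {R | cns x R ∈ G} := by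
  have hb := TopologicalSpace.isBasis_countableBasis (ℕ → K)
  have hc := TopologicalSpace.countable_countableBasis (ℕ → K)
  have main : ∀ V ∈ TopologicalSpace.countableBasis (ℕ → K),
      ∀ᶠ x in residual K, ∃ R ∈ V, cns x R ∈ G := by
    intro V hV
    have hVo : IsOpen V := hb.isOpen hV
    apply residual_of_dense_open
    · have : {x : K | ∃ R ∈ V, cns x R ∈ G} = ⋃ R ∈ V, (fun x => cns x R) ⁻¹' G := by
        ext x; simp
      have h2 : IsOpen {x : K | ∃ R ∈ V, cns x R ∈ G} := by
        rw [this]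
        exact isOpen_biUnion fun R _ => hG.preimage
          (continuous_cns.comp (continuous_id.prodMk continuous_const))
      exact h2
    · have h2 : Dense {x : K | ∃ R ∈ V, cns x R ∈ G} := by
        rw [dense_iff_inter_open]
        rintro N hN ⟨x, hx⟩
        have hVn : V.Nonempty := TopologicalSpace.nonempty_of_mem_countableBasis hV
        obtain ⟨R, hR⟩ := hVn
        have ho : IsOpen {y : ℕ → K | y 0 ∈ N ∧ (fun k => y (k + 1)) ∈ V} :=
          (hN.preimage (continuous_apply 0)).inter
            (hVo.preimage (continuous_pi fun k => continuous_apply (k + 1)))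
        obtain ⟨y, ⟨hy1, hy2⟩, hyG⟩ := hd.inter_open_nonempty _ ho ⟨cns x R, hx, hR⟩
        exact ⟨y 0, hy1, _, hy2, by rwa [cns_shift]⟩
      exact h2
  have := (eventually_countable_ball hc).2 main
  filter_upwards [this] with x hx
  rw [hb.dense_iff]
  intro V hV _
  obtain ⟨R, h1, h2⟩ := hx V hV
  exact ⟨R, h1, h2⟩

/-- a box in a countable power -/
def IsBox {K : Type*} [TopologicalSpace K] (O : ℕ → Set K) : Prop :=
  (∀ k, IsOpen (O k)) ∧ (∀ k, (O k).Nonempty) ∧ ∃ I : Finset ℕ, ∀ k ∉ I, O k = univ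

lemma IsBox.isOpen {K : Type*} [TopologicalSpace K] {O : ℕ → Set K} (h : IsBox O) :
    IsOpen (Set.pi univ O) := by
  obtain ⟨h1, h2, I, hI⟩ := h
  have : Set.pi univ O = Set.pi (I : Set ℕ) O := by
    ext y
    simp only [Set.mem_pi, mem_univ, true_imp_iff]
    refine ⟨fun h i _ => h i, fun h i => ?_⟩
    by_cases hi : i ∈ I
    · exact h i hi
    · simp [hI i hi]
  rw [this]
  exact isOpen_set_pi I.finite_toSet fun i _ => h1 i

lemma IsBox.nonempty {K : Type*} [TopologicalSpace K] {O : ℕ → Set K} (h : IsBox O) :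
    (Set.pi univ O).Nonempty := Set.univ_pi_nonempty_iff.2 h.2.1

lemma IsBox.tail {K : Type*} [TopologicalSpace K] {O : ℕ → Set K} (h : IsBox O) :
    IsBox (fun k => O (k + 1)) := by
  obtain ⟨h1, h2, I, hI⟩ := h
  refine ⟨fun k => h1 _, fun k => h2 _, I.image (fun k => k - 1), fun k hk => hI _ fun h => hk ?_⟩
  exact Finset.mem_image.2 ⟨k + 1, h, rfl⟩

lemma exists_box {K : Type*} [TopologicalSpace K] {S : Set (ℕ → K)} (hS : IsOpen S)
    (hne : S.Nonempty) : ∃ O : ℕ → Set K, IsBox O ∧ Set.pi univ O ⊆ S := by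
  classical
  obtain ⟨r, hr⟩ := hne
  rw [isOpen_pi_iff] at hS
  obtain ⟨I, u, hu, hsub⟩ := hS r hr
  refine ⟨fun k => if k ∈ I then u k else univ, ⟨fun k => ?_, fun k => ?_, I, fun k hk => ?_⟩, ?_⟩
  · by_cases hk : k ∈ I
    · simp [hk, (hu k hk).1]
    · simp [hk]
  · by_cases hk : k ∈ I
    · simp only [hk, if_true]; exact ⟨_, (hu k hk).2⟩
    · simp only [hk, if_false]; exact ⟨r k, trivial⟩
  · simp [hk]
  · intro y hy
    apply hsub
    intro i hi
    have := hy i trivial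
    rw [Finset.mem_coe] at hi
    simpa [hi] using this

lemma resid_seq {X : Type*} [TopologicalSpace X] {p : X → Prop} (h : ∀ᶠ x in residual X, p x) :
    ∃ G : ℕ → Set X, (∀ i, IsOpen (G i)) ∧ (∀ i, Dense (G i)) ∧ ∀ x, (∀ i, x ∈ G i) → p x := by
  obtain ⟨S, h1, h2, h3, h4⟩ := mem_residual_iff.1 h
  obtain ⟨G, hG⟩ := (h3.insert univ).exists_eq_range ⟨univ, by simp⟩
  have hm : ∀ i, G i ∈ insert univ S := fun i => hG ▸ mem_range_self i
  refine ⟨G, fun i => ?_, fun i => ?_, fun x hx => h4 ?_⟩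
  · rcases hm i with h | h
    · rw [h]; exact isOpen_univ
    · exact h1 _ h
  · rcases hm i with h | h
    · rw [h]; exact dense_univ
    · exact h2 _ h
  · intro t ht
    have : t ∈ range G := hG ▸ Or.inr ht
    obtain ⟨i, rfl⟩ := this
    exact hx i

theorem lemmaD {K : Type*} [TopologicalSpace K] [SecondCountableTopology K] [BaireSpace (ℕ → K)]
    [BaireSpace K] [Nonempty K]
    (Z : ℕ → Set (ℕ → K)) (hZ : ∀ y, ∃ n, y ∈ Z n) :
    ∃ (n : ℕ) (p : ℕ → K) (N : Set K) (O : Set (ℕ → K)), IsOpen N ∧ N.Nonempty ∧ IsOpen O ∧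
      O.Nonempty ∧ ∀ᶠ x in residual K, x ∈ N → ∀ O' ⊆ O, IsOpen O' → O'.Nonempty →
        ¬ (∀ᶠ R in residual (ℕ → K), R ∈ O' → glu n p (cns x R) ∉ Z n) := by
  by_contra H
  push Not at H
  let St := (ℕ → K) × (ℕ → Set K) × (ℕ → Set (ℕ → K))
  let val : St → Prop := fun s => IsBox s.2.1 ∧ ∀ i, IsOpen (s.2.2 i) ∧ Dense (s.2.2 i)
  let Q : ℕ → St → St → Prop := fun n s t =>
    val t ∧ (∀ k < n, t.1 k = s.1 k) ∧ t.1 n ∈ s.2.1 0 ∧ (∀ k, t.2.1 k ⊆ s.2.1 (k + 1)) ∧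
    (∀ R ∈ Set.pi univ t.2.1, ∀ i ≤ n, cns (t.1 n) R ∈ s.2.2 i) ∧
    (∀ R i, R ∈ t.2.2 i → cns (t.1 n) R ∈ s.2.2 i) ∧
    (∀ R ∈ Set.pi univ t.2.1, (∀ i, R ∈ t.2.2 i) → glu n s.1 (cns (t.1 n) R) ∉ Z n)
  have step : ∀ n s, val s → ∃ t, Q n s t := by
    rintro n ⟨p, O, G⟩ ⟨hO, hG⟩
    dsimp only at hO hG
    have hGd : Dense (⋂ i ∈ Set.Iic n, G i) :=
      dense_biInter_of_isOpen (fun i _ => (hG i).1) (Set.to_countable _) (fun i _ => (hG i).2)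
    have hGo : IsOpen (⋂ i ∈ Set.Iic n, G i) :=
      (Set.finite_Iic n).isOpen_biInter fun i _ => (hG i).1
    obtain ⟨B, hB, hBs⟩ := exists_box (hO.isOpen.inter hGo)
      (hGd.inter_open_nonempty _ hO.isOpen hO.nonempty)
    have hH := H n p (B 0) (Set.pi univ fun k => B (k + 1)) (hB.1 0) (hB.2.1 0)
      hB.tail.isOpen hB.tail.nonempty
    have hku : ∀ᶠ x in residual K, ∀ i, Dense {R | cns x R ∈ G i} :=
      eventually_countable_forall.2 fun i => ku (hG i).1 (hG i).2
    obtain ⟨x, hx, hxk⟩ := (hH.and_eventually hku).exists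
    obtain ⟨hxN, O', hO'1, hO'2, hO'3, hres⟩ := hx
    obtain ⟨G', g1, g2, g3⟩ := resid_seq hres
    obtain ⟨B', hB', hB's⟩ := exists_box hO'2 hO'3
    refine ⟨⟨fun k => if k = n then x else p k, B', fun i => {R | cns x R ∈ G i} ∩ G' i⟩,
      ⟨hB', fun i => ⟨?_, ?_⟩⟩, ?_, ?_, ?_, ?_, ?_, ?_⟩
    · exact ((hG i).1.preimage (continuous_cns.comp
        (continuous_const.prodMk continuous_id))).inter (g1 i)
    · exact (hxk i).inter_of_isOpen_right (g2 i) (g1 i)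
    · intro k hk; simp [hk.ne]
    · simp only [if_true]
      obtain ⟨R, hR⟩ := hB.tail.nonempty
      have : cns x R ∈ Set.pi univ B := by
        intro k _
        cases k with
        | zero => exact hxN
        | succ k => exact hR k trivial
      exact (hBs this).1 0 trivial
    · intro k y hy
      obtain ⟨R, hR⟩ := hB'.nonempty
      have h2 : Function.update R k y ∈ Set.pi univ B' := by
        intro i _
        by_cases hi : i = k
        · subst hi; simpa using hy
        · simpa [hi] using hR i trivial
      have h3 := hO'1 (hB's h2)
      have h4 : cns x (Function.update R k y) ∈ Set.pi univ B := by
        intro k _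
        cases k with
        | zero => exact hxN
        | succ k => exact h3 k trivial
      have := (hBs h4).1 (k + 1) trivial
      simpa [cns] using this
    · intro R hR i hi
      simp only [if_true]
      have h4 : cns x R ∈ Set.pi univ B := by
        intro k _
        cases k with
        | zero => exact hxN
        | succ k => exact hO'1 (hB's hR) k trivial
      have := (hBs h4).2
      exact Set.mem_iInter₂.1 this i hi
    · rintro R i ⟨h1, -⟩
      simpa using h1
    · intro R hR hi
      simp only [if_true]
      exact g3 R (fun i => (hi i).2) (hB's hR)
  let x0 : K := Classical.arbitrary K
  let s0 : St := ⟨fun _ => x0, fun _ => univ, fun _ => univ⟩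
  have hs0 : val s0 := ⟨⟨fun _ => isOpen_univ, fun _ => ⟨x0, trivial⟩, ∅, fun _ _ => rfl⟩,
    fun i => ⟨isOpen_univ, dense_univ⟩⟩
  choose! nx hnx using step
  let s : ℕ → St := fun n => Nat.rec s0 (fun n s => nx n s) n
  have sval : ∀ n, val (s n) := by
    intro n
    induction n with
    | zero => exact hs0
    | succ n ih => exact (hnx n (s n) ih).1
  have sQ : ∀ n, Q n (s n) (s (n + 1)) := fun n => hnx n (s n) (sval n)
  let y : ℕ → K := fun k => (s (k + 1)).1 k
  have yp : ∀ n k, k < n → (s n).1 k = y k := by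
    intro n
    induction n with
    | zero => intro k hk; omega
    | succ n ih =>
      intro k hk
      rcases Nat.lt_succ_iff_lt_or_eq.1 hk with h | h
      · rw [(sQ n).2.1 k h]; exact ih k h
      · subst h; rfl
  have ybox : ∀ i n, y (n + i) ∈ (s n).2.1 i := by
    intro i
    induction i with
    | zero => intro n; exact (sQ n).2.2.1
    | succ i ih =>
      intro n
      have := (sQ n).2.2.2.1 i (ih (n + 1))
      rwa [show n + 1 + i = n + (i + 1) by ring] at this
  let tl : ℕ → ℕ → K := fun n k => y (n + k)
  have tl_cns : ∀ n, cns ((s (n + 1)).1 n) (tl (n + 1)) = tl n := by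
    intro n
    funext k
    cases k with
    | zero => rfl
    | succ k => simp only [cns, tl]; congr 1; omega
  have tlbox : ∀ n, tl n ∈ Set.pi univ (s n).2.1 := fun n k _ => ybox k n
  have avoid1 : ∀ n, ∀ i ≤ n, tl n ∈ (s n).2.2 i := by
    intro n i hi
    have := (sQ n).2.2.2.2.1 (tl (n + 1)) (tlbox (n + 1)) i hi
    rwa [tl_cns] at this
  have avoid2 : ∀ d n i, i ≤ n + d → tl n ∈ (s n).2.2 i := by
    intro d
    induction d with
    | zero => intro n i hi; exact avoid1 n i hi
    | succ d ih =>
      intro n i hi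
      have := (sQ n).2.2.2.2.2.1 _ _ (ih (n + 1) i (by omega))
      rwa [tl_cns] at this
  obtain ⟨n, hn⟩ := hZ y
  refine (sQ n).2.2.2.2.2.2 (tl (n + 1)) (tlbox (n + 1)) (fun i => avoid2 i (n + 1) i (by omega)) ?_
  rw [tl_cns]
  convert hn using 1
  funext k
  by_cases hk : k < n
  · simp [glu, hk, yp n k hk]
  · simp only [glu, hk, if_false, tl]; congr 1; omega




/-- a homomorphism modulo finite sets -/
structure HomMod {B : Type} (Ψ : Set B → Set ℕ) : Prop where
  union : ∀ X Y, AEq (Ψ (X ∪ Y)) (Ψ X ∪ Ψ Y)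
  inter : ∀ X Y, AEq (Ψ (X ∩ Y)) (Ψ X ∩ Ψ Y)
  diff : ∀ X Y, AEq (Ψ (X \ Y)) (Ψ X \ Ψ Y)

lemma HomMod.empty {B : Type} {Ψ : Set B → Set ℕ} (h : HomMod Ψ) : ∀ᶠ j in atTop, j ∉ Ψ ∅ := by
  have := h.diff ∅ ∅
  rw [Set.diff_self] at this
  filter_upwards [this] with j hj h'
  exact (hj.1 h').2 (hj.1 h').1

lemma HomMod.mono {B : Type} {Ψ : Set B → Set ℕ} (h : HomMod Ψ) {X Y : Set B} (hXY : X ⊆ Y) :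
    ∀ᶠ j in atTop, j ∈ Ψ X → j ∈ Ψ Y := by
  have := h.inter X Y
  rw [Set.inter_eq_left.2 hXY] at this
  filter_upwards [this] with j hj h'
  exact (hj.1 h').2

/-- complete additivity on `E` modulo finite -/
def CA {B : Type} (Ψ : Set B → Set ℕ) (E : Set B) : Prop :=
  ∃ K : B → Set ℕ, (∀ e ∈ E, ∀ e' ∈ E, e ≠ e' → Disjoint (K e) (K e')) ∧
    ∀ X ⊆ E, AEq (Ψ X) {j | ∃ e ∈ X, j ∈ K e}

lemma CA.mono {B : Type} {Ψ : Set B → Set ℕ} {E E' : Set B} (h : CA Ψ E) (hs : E' ⊆ E) :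
    CA Ψ E' := by
  obtain ⟨K, h1, h2⟩ := h
  exact ⟨K, fun e he e' he' => h1 e (hs he) e' (hs he'), fun X hX => h2 X (hX.trans hs)⟩

lemma CA.union {B : Type} {Ψ : Set B → Set ℕ} (hΨ : HomMod Ψ) {E E' : Set B} (h : CA Ψ E)
    (h' : CA Ψ E') : CA Ψ (E ∪ E') := by
  classical
  obtain ⟨K, h1, h2⟩ := h
  obtain ⟨K', h1', h2'⟩ := h'
  refine ⟨fun e => if e ∈ E then K e \ Ψ (E' \ E) else K' e ∩ Ψ (E' \ E), ?_, ?_⟩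
  · intro e he e' he' hne
    by_cases c : e ∈ E <;> by_cases c' : e' ∈ E
    · simp only [c, c', if_true]
      exact (h1 e c e' c' hne).mono sdiff_le sdiff_le
    · simp only [c, c', if_true, if_false]
      rw [Set.disjoint_left]
      rintro j ⟨_, q⟩ ⟨_, q'⟩
      exact q q'
    · simp only [c, c', if_true, if_false]
      rw [Set.disjoint_left]
      rintro j ⟨_, q⟩ ⟨_, q'⟩
      exact q' q
    · simp only [c, c', if_false]
      exact (h1' e (he.resolve_left c) e' (he'.resolve_left c') hne).mono inf_le_left inf_le_left
  · intro X hX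
    have a1 := hΨ.union (X ∩ E) (X \ E)
    rw [Set.inter_union_diff] at a1
    have a2 := h2 (X ∩ E) inter_subset_right
    have sub : X \ E ⊆ E' := fun e he => (hX he.1).resolve_left he.2
    have a3 := h2' (X \ E) sub
    have a4 := hΨ.mono (X := X \ E) (Y := E' \ E) fun e he => ⟨sub he, he.2⟩
    have a5 := hΨ.inter (X ∩ E) (E' \ E)
    rw [show (X ∩ E) ∩ (E' \ E) = ∅ by ext; simp; tauto] at a5
    filter_upwards [a1, a2, a3, a4, a5, hΨ.empty] with j a1 a2 a3 a4 a5 a6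
    rw [a1]
    simp only [mem_union, mem_ofPred_eq]
    constructor
    · rintro (q | q)
      · obtain ⟨e, he, hj⟩ := a2.1 q
        refine ⟨e, he.1, ?_⟩
        simp only [he.2, if_true]
        exact ⟨hj, fun q' => a6 (a5.2 ⟨q, q'⟩)⟩
      · obtain ⟨e, he, hj⟩ := a3.1 q
        refine ⟨e, he.1, ?_⟩
        simp only [he.2, if_false]
        exact ⟨hj, a4 q⟩
    · rintro ⟨e, he, hj⟩
      by_cases c : e ∈ E
      · simp only [c, if_true] at hj
        exact Or.inl (a2.2 ⟨e, ⟨he, c⟩, hj.1⟩)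
      · simp only [c, if_false] at hj
        exact Or.inr (a3.2 ⟨e, ⟨he, c⟩, hj.1⟩)

lemma CA.empty {B : Type} {Ψ : Set B → Set ℕ} (hΨ : HomMod Ψ) : CA Ψ ∅ := by
  refine ⟨fun _ => ∅, by simp, fun X hX => ?_⟩
  filter_upwards [hΨ.empty] with j hj
  obtain rfl := Set.subset_empty_iff.1 hX
  simpa using hj

lemma CA.singleton {B : Type} {Ψ : Set B → Set ℕ} (hΨ : HomMod Ψ) (e : B) : CA Ψ {e} := by
  refine ⟨fun _ => Ψ {e}, ?_, fun X hX => ?_⟩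
  · intro a ha b hb hne
    exact absurd (ha.trans hb.symm) hne
  · rcases Set.subset_singleton_iff_eq.1 hX with rfl | rfl
    · filter_upwards [hΨ.empty] with j hj
      simpa using hj
    · exact Eventually.of_forall fun j => by simp

lemma CA.finite {B : Type} {Ψ : Set B → Set ℕ} (hΨ : HomMod Ψ) {E : Set B} (h : E.Finite) :
    CA Ψ E := by
  induction E, h using Set.Finite.induction_on with
  | empty => exact CA.empty hΨ
  | insert _ _ ih => exact (CA.singleton hΨ _).union hΨ ih

lemma resid_frontier {X : Type*} [TopologicalSpace X] {C : Set X} (hC : IsClosed C) :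
    ∀ᶠ x in residual X, x ∈ C → x ∈ interior C := by
  have : (frontier C)ᶜ ∈ residual X := residual_of_dense_open isClosed_frontier.isOpen_compl
    (interior_eq_empty_iff_dense_compl.1 (interior_frontier hC))
  filter_upwards [this] with x hx h
  by_contra h'
  exact hx ⟨subset_closure h, h'⟩

/-- the subset coded by a point -/
def cod {B : Type} (e : ℕ → ℕ → B) (y : ℕ → ℕ → Bool) : Set B := {c | ∃ k i, y k i = true ∧ e k i = c}

/-- lower semicontinuity -/
def Lsc {B : Type} (b : Set B) (F : Set B → Set ℕ) : Prop :=
  ∀ j a, a ⊆ b → j ∈ F a → ∃ I : Set B, I.Finite ∧ ∀ a' ⊆ b, (∀ c ∈ I, c ∈ a' ↔ c ∈ a) → j ∈ F a'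

lemma lsc_open {B : Type} {b : Set B} {F : Set B → Set ℕ} (hF : Lsc b F) (e : ℕ → ℕ → B)
    (heb : ∀ k i, e k i ∈ b) (hinj : ∀ k i k' i', e k i = e k' i' → k = k' ∧ i = i') (j : ℕ) :
    IsOpen {y | j ∈ F (cod e y)} := by
  have hsub : ∀ y, cod e y ⊆ b := by rintro y c ⟨k, i, -, rfl⟩; exact heb k i
  rw [isOpen_iff_mem_nhds]
  intro y hy
  obtain ⟨I, hI, hI'⟩ := hF j _ (hsub y) hy
  have : ∀ c ∈ I, ∀ᶠ y' in 𝓝 y, (c ∈ cod e y' ↔ c ∈ cod e y) := by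
    intro c _
    by_cases hc : ∃ k i, e k i = c
    · obtain ⟨k, i, rfl⟩ := hc
      have key : ∀ y, e k i ∈ cod e y ↔ y k i = true := by
        intro y
        constructor
        · rintro ⟨k', i', h, h'⟩
          obtain ⟨rfl, rfl⟩ := hinj _ _ _ _ h'
          exact h
        · intro h; exact ⟨k, i, h, rfl⟩
      have ho : IsOpen ((fun y' : ℕ → ℕ → Bool => y' k i) ⁻¹' {y k i}) :=
        (isOpen_discrete _).preimage ((continuous_apply i).comp (continuous_apply k))
      filter_upwards [ho.mem_nhds (by simp : y ∈ _)] with y' hy'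
      have : y' k i = y k i := hy'
      rw [key, key, this]
    · refine Eventually.of_forall fun y' => ⟨?_, ?_⟩ <;>
      · rintro ⟨k, i, -, h⟩; exact absurd ⟨k, i, h⟩ hc
  filter_upwards [(eventually_all_finite hI).2 this] with y' hy'
  exact hI' _ (hsub y') hy'

theorem desc_core {B : Type} {Ψ : Set B → Set ℕ} (hΨ : HomMod Ψ) (b : Set B) (e : ℕ → ℕ → B)
    (heb : ∀ k i, e k i ∈ b) (hinj : ∀ k i k' i', e k i = e k' i' → k = k' ∧ i = i')
    (F Fc : ℕ → Set B → Set ℕ) (hF : ∀ n, Lsc b (F n)) (hFc : ∀ n, Lsc b (Fc n))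
    (hcov : ∀ a ⊆ b, ∃ n, F n a = Ψ a ∩ Ψ b ∧ Fc n a = Ψ b \ Ψ a) :
    ∃ (n : ℕ) (k : ℕ) (K : ℕ → Set ℕ), (∀ i i', i ≠ i' → Disjoint (K i) (K i')) ∧
      ∀ x : ℕ → Bool, (∀ i < k, x i = false) →
        AEq (Ψ {c | ∃ i, x i = true ∧ e n i = c}) {j | ∃ i, x i = true ∧ j ∈ K i} := by
  have hsub : ∀ y, cod e y ⊆ b := by rintro y c ⟨k, i, -, rfl⟩; exact heb k i
  obtain ⟨n, p, N, O, hN, hNe, hO, hOe, hres⟩ := lemmaD (K := ℕ → Bool)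
    (fun n => {y | F n (cod e y) = Ψ (cod e y) ∩ Ψ b ∧ Fc n (cod e y) = Ψ b \ Ψ (cod e y)})
    (fun y => hcov _ (hsub y))
  let E : Set B := Set.range (e n)
  have hEb : E ⊆ b := by rintro _ ⟨i, rfl⟩; exact heb n i
  let Θ : (ℕ → Bool) → Set ℕ := fun x => Ψ {c | ∃ i, x i = true ∧ e n i = c}
  let W : Set ℕ := Ψ E ∩ Ψ b
  let S : (ℕ → Bool) → (ℕ → ℕ → Bool) → Set B := fun x R => cod e (glu n p (cns x R))
  have einj : ∀ i i', e n i = e n i' → i = i' := fun i i' h => (hinj _ _ _ _ h).2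
  have SE : ∀ x R, S x R ∩ E = {c | ∃ i, x i = true ∧ e n i = c} := by
    intro x R
    ext c
    constructor
    · rintro ⟨⟨k, i, h1, rfl⟩, ⟨i', h2⟩⟩
      obtain ⟨rfl, rfl⟩ := hinj _ _ _ _ h2
      refine ⟨i', ?_, rfl⟩
      simpa [glu, cns] using h1
    · rintro ⟨i, h1, rfl⟩
      exact ⟨⟨n, i, by simpa [glu, cns] using h1, rfl⟩, ⟨i, rfl⟩⟩
  have hΘW : ∀ x, ∀ᶠ j in atTop, j ∈ Θ x → j ∈ W := by
    intro x
    have s1 : {c | ∃ i, x i = true ∧ e n i = c} ⊆ E := by rintro _ ⟨i, _, rfl⟩; exact ⟨i, rfl⟩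
    filter_upwards [hΨ.mono s1, hΨ.mono (s1.trans hEb)] with j h1 h2 h
    exact ⟨h1 h, h2 h⟩
  have hSΘ : ∀ x R, ∀ᶠ j in atTop, j ∈ W → (j ∈ Ψ (S x R) ↔ j ∈ Θ x) := by
    intro x R
    have := hΨ.inter (S x R) E
    rw [SE] at this
    filter_upwards [this] with j h1 hW
    change j ∈ Θ x ↔ _ at h1
    rw [h1]
    exact ⟨fun h => ⟨h, hW.1⟩, fun h => h.1⟩
  have hcont : Continuous (fun q : (ℕ → Bool) × (ℕ → ℕ → Bool) => glu n p (cns q.1 q.2)) :=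
    (continuous_glu n p).comp continuous_cns
  have opF : ∀ j, IsOpen {q : (ℕ → Bool) × (ℕ → ℕ → Bool) | j ∈ F n (S q.1 q.2)} := fun j =>
    (lsc_open (hF n) e heb hinj j).preimage hcont
  have opFc : ∀ j, IsOpen {q : (ℕ → Bool) × (ℕ → ℕ → Bool) | j ∈ Fc n (S q.1 q.2)} := fun j =>
    (lsc_open (hFc n) e heb hinj j).preimage hcont
  have c1 : ∀ x : ℕ → Bool, Continuous fun R : ℕ → ℕ → Bool => (x, R) := fun x =>
    continuous_const.prodMk continuous_id
  have c2 : ∀ R : ℕ → ℕ → Bool, Continuous fun x : ℕ → Bool => (x, R) := fun R =>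
    continuous_id.prodMk continuous_const
  let T : Set (ℕ → ℕ → Bool) → ℕ → Set (ℕ → Bool) := fun O1 m => {x | ∀ j ≥ m, j ∈ W →
    ((∃ R ∈ O1, j ∈ F n (S x R)) → j ∈ Θ x) ∧ ((∃ R ∈ O1, j ∈ Fc n (S x R)) → j ∉ Θ x) ∧
    ((∃ R ∈ O1, j ∈ F n (S x R)) ∨ (∃ R ∈ O1, j ∈ Fc n (S x R)))}
  let bas := TopologicalSpace.countableBasis (ℕ → ℕ → Bool)
  have hb := TopologicalSpace.isBasis_countableBasis (ℕ → ℕ → Bool)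
  have good : ∀ᶠ x in residual (ℕ → Bool), x ∈ N → ∀ O' ⊆ O, IsOpen O' → O'.Nonempty →
      ∃ O1 ∈ bas, O1 ⊆ O' ∧ O1.Nonempty ∧ ∃ m, x ∈ T O1 m := by
    filter_upwards [hres] with x hx hxN O' hO' hO'o hO'n
    have hx' := hx hxN O' hO' hO'o hO'n
    let cond : ℕ → Set (ℕ → ℕ → Bool) := fun m => {R | ∀ j ≥ m, j ∈ W →
      (j ∈ F n (S x R) → j ∈ Θ x) ∧ (j ∈ Fc n (S x R) → j ∉ Θ x)}
    have hcond : ∀ m, IsClosed (cond m) := by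
      intro m
      have : cond m = ⋂ j ∈ {j | j ≥ m ∧ j ∈ W},
          ({R | j ∈ F n (S x R) ∧ j ∉ Θ x} ∪ {R | j ∈ Fc n (S x R) ∧ j ∈ Θ x})ᶜ := by
        ext R
        simp only [cond, mem_iInter, mem_compl_iff, mem_union, mem_ofPred_eq]
        constructor
        · rintro h j ⟨h1, h2⟩ (h3 | h3)
          · exact h3.2 ((h j h1 h2).1 h3.1)
          · exact (h j h1 h2).2 h3.1 h3.2
        · intro h j h1 h2
          have := h j ⟨h1, h2⟩
          tauto
      rw [this]
      refine isClosed_biInter fun j _ => IsOpen.isClosed_compl (IsOpen.union ?_ ?_)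
      · exact ((opF j).preimage (c1 x)).inter isOpen_const
      · exact ((opFc j).preimage (c1 x)).inter isOpen_const
    have hfr : ∀ᶠ R in residual (ℕ → ℕ → Bool), ∀ m, R ∈ cond m → R ∈ interior (cond m) :=
      eventually_countable_forall.2 fun m => resid_frontier (hcond m)
    have : ∃ R, R ∈ O' ∧ (F n (S x R) = Ψ (S x R) ∩ Ψ b ∧ Fc n (S x R) = Ψ b \ Ψ (S x R)) ∧
        ∀ m, R ∈ cond m → R ∈ interior (cond m) := by
      by_contra hno
      apply hx'
      filter_upwards [hfr] with R hR hRO hZ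
      exact hno ⟨R, hRO, hZ, hR⟩
    obtain ⟨R, hRO, ⟨hZ1, hZ2⟩, hRi⟩ := this
    obtain ⟨m, hm⟩ := eventually_atTop.1 (hSΘ x R)
    have hRm : R ∈ cond m := by
      intro j hj hW
      have := hm j hj hW
      rw [hZ1, hZ2]
      exact ⟨fun h => this.1 h.1, fun h h' => h.2 (this.2 h')⟩
    obtain ⟨O1, h1, h2, h3⟩ := hb.exists_subset_of_mem_open
      (show R ∈ interior (cond m) ∩ O' from ⟨hRi m hRm, hRO⟩) (isOpen_interior.inter hO'o)
    refine ⟨O1, h1, fun r hr => (h3 hr).2, ⟨R, h2⟩, m, ?_⟩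
    intro j hj hW
    refine ⟨?_, ?_, ?_⟩
    · rintro ⟨r, hr, hrj⟩
      exact (interior_subset (h3 hr).1 j hj hW).1 hrj
    · rintro ⟨r, hr, hrj⟩
      exact (interior_subset (h3 hr).1 j hj hW).2 hrj
    · by_cases hS : j ∈ Ψ (S x R)
      · exact Or.inl ⟨R, h2, by rw [hZ1]; exact ⟨hS, hW.2⟩⟩
      · exact Or.inr ⟨R, h2, by rw [hZ2]; exact ⟨hW.2, hS⟩⟩
  have hfr : ∀ᶠ x in residual (ℕ → Bool), ∀ O1 ∈ bas, ∀ m, x ∈ closure (T O1 m) →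
      x ∈ interior (closure (T O1 m)) :=
    (eventually_countable_ball (TopologicalSpace.countable_countableBasis _)).2 fun O1 _ =>
      eventually_countable_forall.2 fun m => resid_frontier isClosed_closure
  obtain ⟨x0, hx0N, hx0g, hx0f⟩ : ∃ x, x ∈ N ∧ (x ∈ N → ∀ O' ⊆ O, IsOpen O' → O'.Nonempty →
      ∃ O1 ∈ bas, O1 ⊆ O' ∧ O1.Nonempty ∧ ∃ m, x ∈ T O1 m) ∧
      ∀ O1 ∈ bas, ∀ m, x ∈ closure (T O1 m) → x ∈ interior (closure (T O1 m)) := by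
    obtain ⟨x, h1, h2⟩ := (dense_of_mem_residual (good.and hfr)).inter_open_nonempty N hN hNe
    exact ⟨x, h1, h2.1, h2.2⟩
  obtain ⟨O1, hO1b, hO1O, hO1n, m, hxT⟩ := hx0g hx0N O Subset.rfl hO hOe
  have hxi := hx0f O1 hO1b m (subset_closure hxT)
  have hO1o : IsOpen O1 := hb.isOpen hO1b
  have uo : ∀ j, IsOpen {x | ∃ R ∈ O1, j ∈ F n (S x R)} := by
    intro j
    have : {x | ∃ R ∈ O1, j ∈ F n (S x R)} = ⋃ R ∈ O1, {x | j ∈ F n (S x R)} := by ext; simp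
    rw [this]
    exact isOpen_biUnion fun R _ => (opF j).preimage (c2 R)
  have vo : ∀ j, IsOpen {x | ∃ R ∈ O1, j ∈ Fc n (S x R)} := by
    intro j
    have : {x | ∃ R ∈ O1, j ∈ Fc n (S x R)} = ⋃ R ∈ O1, {x | j ∈ Fc n (S x R)} := by ext; simp
    rw [this]
    exact isOpen_biUnion fun R _ => (opFc j).preimage (c2 R)
  let N' := N ∩ interior (closure (T O1 m))
  have hN' : IsOpen N' := hN.inter isOpen_interior
  have dens : ∀ M, IsOpen M → (N' ∩ M).Nonempty → ∃ x ∈ M, x ∈ T O1 m := by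
    rintro M hM ⟨x, hx1, hx2⟩
    obtain ⟨z, hz1, hz2⟩ := mem_closure_iff.1 (interior_subset hx1.2) M hM hx2
    exact ⟨z, hz1, hz2⟩
  refine ⟨n, ?_⟩
  refine ca_lemma Θ ?_ ?_ ?_
    (fun j => {x | (m ≤ j ∧ j ∈ W) ∧ x ∈ {x | ∃ R ∈ O1, j ∈ F n (S x R)}})
    (fun j => {x | (m ≤ j ∧ j ∈ W) → x ∈ {x | ∃ R ∈ O1, j ∈ Fc n (S x R)}}) ?_ ?_
    N' hN' ⟨x0, hx0N, hxi⟩ ?_ ?_ ?_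
  · intro x y
    have := hΨ.union {c | ∃ i, x i = true ∧ e n i = c} {c | ∃ i, y i = true ∧ e n i = c}
    convert this using 2
    ext c
    simp only [mem_ofPred_eq, mem_union, Bool.or_eq_true]
    constructor
    · rintro ⟨i, h | h, h'⟩
      · exact Or.inl ⟨i, h, h'⟩
      · exact Or.inr ⟨i, h, h'⟩
    · rintro (⟨i, h, h'⟩ | ⟨i, h, h'⟩)
      · exact ⟨i, Or.inl h, h'⟩
      · exact ⟨i, Or.inr h, h'⟩
  · intro x y
    have := hΨ.inter {c | ∃ i, x i = true ∧ e n i = c} {c | ∃ i, y i = true ∧ e n i = c}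
    convert this using 2
    ext c
    simp only [mem_ofPred_eq, mem_inter_iff, Bool.and_eq_true]
    constructor
    · rintro ⟨i, ⟨h, h2⟩, h'⟩
      exact ⟨⟨i, h, h'⟩, ⟨i, h2, h'⟩⟩
    · rintro ⟨⟨i, h, h'⟩, ⟨i2, h2, h2'⟩⟩
      obtain rfl := einj _ _ (h'.trans h2'.symm)
      exact ⟨i, ⟨h, h2⟩, h'⟩
  · intro x y
    have := hΨ.diff {c | ∃ i, x i = true ∧ e n i = c} {c | ∃ i, y i = true ∧ e n i = c}
    convert this using 2
    ext c
    simp only [mem_ofPred_eq, Set.mem_sdiff, Bool.and_eq_true, Bool.not_eq_true']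
    constructor
    · rintro ⟨i, ⟨h, h2⟩, h'⟩
      refine ⟨⟨i, h, h'⟩, ?_⟩
      rintro ⟨i2, h3, h3'⟩
      obtain rfl := einj _ _ (h'.trans h3'.symm)
      simp [h2] at h3
    · rintro ⟨⟨i, h, h'⟩, h2⟩
      refine ⟨i, ⟨h, ?_⟩, h'⟩
      by_contra h3
      exact h2 ⟨i, by simpa using h3, h'⟩
  · intro j
    by_cases hj : m ≤ j ∧ j ∈ W
    · simp only [hj, true_and]; simpa using uo j
    · simp only [hj, false_and]; exact isOpen_empty
  · intro j
    by_cases hj : m ≤ j ∧ j ∈ W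
    · simp only [hj]; simpa using vo j
    · simp only [hj, false_imp_iff]; exact isOpen_univ
  · rintro j x hx ⟨hj, hu⟩ hv
    obtain ⟨z, hz, hzT⟩ := dens _ ((uo j).inter (vo j)) ⟨x, hx, hu, hv hj⟩
    have := hzT j hj.1 hj.2
    exact this.2.1 hz.2 (this.1 hz.1)
  · have : ∀ j, ∀ᶠ x in residual (ℕ → Bool), x ∈ N' → (m ≤ j ∧ j ∈ W) →
        (∃ R ∈ O1, j ∈ F n (S x R)) ∨ (∃ R ∈ O1, j ∈ Fc n (S x R)) := by
      intro j
      by_cases hj : m ≤ j ∧ j ∈ W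
      · have ho := (uo j).union (vo j)
        filter_upwards [resid_frontier ho.isClosed_compl] with x hx hxN _
        by_contra hne
        have h1 := hx (fun h => hne h)
        obtain ⟨z, hz, hzT⟩ := dens _ isOpen_interior ⟨x, hxN, h1⟩
        exact interior_subset hz (hzT j hj.1 hj.2).2.2
      · exact Eventually.of_forall fun x _ h => absurd h hj
    filter_upwards [eventually_countable_forall.2 this] with x hx hxN j
    by_cases hj : m ≤ j ∧ j ∈ W
    · rcases hx j hxN hj with h | h
      · exact Or.inl ⟨hj, h⟩
      · exact Or.inr fun _ => h
    · exact Or.inr fun h => absurd h hj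
  · filter_upwards [good] with x hx hxN'
    obtain ⟨O2, hO2b, hO2, -, m2, hT2⟩ := hx hxN'.1 O1 hO1O hO1o hO1n
    filter_upwards [hΘW x, eventually_ge_atTop m, eventually_ge_atTop m2] with j hW hm hm2
    by_cases hjW : j ∈ W
    · obtain ⟨t1, t2, t3⟩ := hT2 j hm2 hjW
      constructor
      · intro hΘ
        refine ⟨⟨hm, hjW⟩, ?_⟩
        rcases t3 with ⟨R, hR, h⟩ | h
        · exact ⟨R, hO2 hR, h⟩
        · exact absurd hΘ (t2 h)
      · rintro ⟨-, hu⟩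
        rcases t3 with h | ⟨R, hR, h⟩
        · exact t1 h
        · exfalso
          obtain ⟨z, hz, hzT⟩ := dens _ ((uo j).inter (vo j)) ⟨x, hxN', hu, ⟨R, hO2 hR, h⟩⟩
          have := hzT j hm hjW
          exact this.2.1 hz.2 (this.1 hz.1)
    · exact ⟨fun h => absurd (hW h) hjW, fun h => absurd h.1.2 hjW⟩

theorem desc {B : Type} [Countable B] {Ψ : Set B → Set ℕ} (hΨ : HomMod Ψ) (b : Set B)
    (E : ℕ → Set B) (hEb : ∀ k, E k ⊆ b) (hdis : ∀ k k', k ≠ k' → Disjoint (E k) (E k'))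
    (F Fc : ℕ → Set B → Set ℕ) (hF : ∀ n, Lsc b (F n)) (hFc : ∀ n, Lsc b (Fc n))
    (hcov : ∀ a ⊆ b, ∃ n, F n a = Ψ a ∩ Ψ b ∧ Fc n a = Ψ b \ Ψ a) : ∃ k, CA Ψ (E k) := by
  by_contra hno
  push Not at hno
  have hinf : ∀ k, (E k).Infinite := fun k h => hno k (CA.finite hΨ h)
  have hen : ∀ k, Nonempty (ℕ ≃ E k) := fun k => by
    have := (hinf k).to_subtype
    obtain ⟨h⟩ := nonempty_denumerable (E k)
    exact ⟨(Denumerable.eqv (E k)).symm⟩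
  let q : ∀ k, ℕ ≃ E k := fun k => (hen k).some
  let e : ℕ → ℕ → B := fun k i => (q k i : B)
  have heb : ∀ k i, e k i ∈ b := fun k i => hEb k (q k i).2
  have hinj : ∀ k i k' i', e k i = e k' i' → k = k' ∧ i = i' := by
    intro k i k' i' h
    have hk : k = k' := by
      by_contra hne
      exact Set.disjoint_left.1 (hdis k k' hne) (q k i).2 (by
        have : ((q k i : B)) = (q k' i' : B) := h
        rw [this]; exact (q k' i').2)
    subst hk
    exact ⟨rfl, (q k).injective (Subtype.ext h)⟩
  obtain ⟨n, k, K, hK, hx⟩ := desc_core hΨ b e heb hinj F Fc hF hFc hcov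
  apply hno n
  have hsplit : E n ⊆ e n '' {i | k ≤ i} ∪ e n '' {i | i < k} := by
    intro c hc
    have : e n ((q n).symm ⟨c, hc⟩) = c := by simp [e]
    rcases le_or_gt k ((q n).symm ⟨c, hc⟩) with h | h
    · exact Or.inl ⟨_, h, this⟩
    · exact Or.inr ⟨_, h, this⟩
  refine CA.mono (CA.union hΨ ?_ (CA.finite hΨ ((Set.finite_lt_nat k).image _))) hsplit
  classical
  have einj : ∀ i i', e n i = e n i' → i = i' := fun i i' h => (hinj _ _ _ _ h).2
  refine ⟨fun c => {j | ∃ i, e n i = c ∧ j ∈ K i}, ?_, ?_⟩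
  · intro c _ c' _ hne
    rw [Set.disjoint_left]
    rintro j ⟨i, h1, h2⟩ ⟨i', h1', h2'⟩
    have : i ≠ i' := by rintro rfl; exact hne (h1.symm.trans h1')
    exact Set.disjoint_left.1 (hK i i' this) h2 h2'
  · intro X hX
    have := hx (fun i => decide (e n i ∈ X)) (fun i hi => by
      simp only [decide_eq_false_iff_not]
      intro h
      obtain ⟨i', h1, h2⟩ := hX h
      obtain rfl := einj _ _ h2
      exact absurd hi (not_lt.2 h1))
    have e1 : {c | ∃ i, decide (e n i ∈ X) = true ∧ e n i = c} = X := by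
      ext c
      simp only [decide_eq_true_eq, mem_ofPred_eq]
      constructor
      · rintro ⟨i, h, rfl⟩; exact h
      · intro h
        obtain ⟨i, _, rfl⟩ := hX h
        exact ⟨i, h, rfl⟩
    rw [e1] at this
    filter_upwards [this] with j hj
    rw [hj]
    simp only [decide_eq_true_eq, mem_ofPred_eq]
    constructor
    · rintro ⟨i, h1, h2⟩; exact ⟨_, h1, i, rfl, h2⟩
    · rintro ⟨c, h1, i, rfl, h2⟩; exact ⟨i, h1, h2⟩




section OcaCore

variable {B I : Type} (T : I → Set (List Bool)) (node : B → List Bool) (Bs : Set B)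
  (Ψ : Set B → Set ℕ)

/-- the part of the base lying over the tree of `i` -/
def bb (i : I) : Set B := {e | e ∈ Bs ∧ node e ∈ T i}

/-- the space that is coloured -/
def X0 : Type := {q : I × Set B × Set B // q.2.1 ⊆ q.2.2 ∧ q.2.2 ⊆ bb T node Bs q.1}

/-- finite approximations of points -/
def pat (k : ℕ) (x : X0 T node Bs) :
    Set (List Bool) × Set B × Set B × Set ℕ × Set ℕ :=
  (T x.1.1 ∩ {s | s.length ≤ k}, x.1.2.1 ∩ {e | e ∈ Bs ∧ (node e).length ≤ k},
    x.1.2.2 ∩ {e | e ∈ Bs ∧ (node e).length ≤ k}, Ψ x.1.2.1 ∩ {j | j ≤ k}, Ψ x.1.2.2 ∩ {j | j ≤ k})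

/-- the colour -/
def K0 : Set (X0 T node Bs × X0 T node Bs) :=
  {q | q.1.1.1 ≠ q.2.1.1 ∧ q.1.1.2.1 ∩ q.2.1.2.2 = q.2.1.2.1 ∩ q.1.1.2.2 ∧
    Ψ q.1.1.2.1 ∩ Ψ q.2.1.2.2 ≠ Ψ q.2.1.2.1 ∩ Ψ q.1.1.2.2}

variable {T node Bs Ψ}

lemma inter_le_eq {α : Type*} {A A' S : Set α} (h : A ∩ S = A' ∩ S) {x : α} (hx : x ∈ S) :
    x ∈ A ↔ x ∈ A' :=
  ⟨fun hA => (h ▸ (⟨hA, hx⟩ : x ∈ A ∩ S) : x ∈ A' ∩ S).1,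
   fun hA => (h.symm ▸ (⟨hA, hx⟩ : x ∈ A' ∩ S) : x ∈ A ∩ S).1⟩

lemma pat_spec {k : ℕ} {x y : X0 T node Bs} (h : pat T node Bs Ψ k x = pat T node Bs Ψ k y) :
    (∀ s : List Bool, s.length ≤ k → (s ∈ T x.1.1 ↔ s ∈ T y.1.1)) ∧
    (∀ e ∈ Bs, (node e).length ≤ k → (e ∈ x.1.2.1 ↔ e ∈ y.1.2.1)) ∧
    (∀ e ∈ Bs, (node e).length ≤ k → (e ∈ x.1.2.2 ↔ e ∈ y.1.2.2)) ∧
    (∀ j ≤ k, (j ∈ Ψ x.1.2.1 ↔ j ∈ Ψ y.1.2.1)) ∧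
    (∀ j ≤ k, (j ∈ Ψ x.1.2.2 ↔ j ∈ Ψ y.1.2.2)) := by
  simp only [pat, Prod.mk.injEq] at h
  obtain ⟨h1, h2, h3, h4, h5⟩ := h
  exact ⟨fun s hs => inter_le_eq h1 hs, fun e he hk => inter_le_eq h2 ⟨he, hk⟩,
    fun e he hk => inter_le_eq h3 ⟨he, hk⟩, fun j hj => inter_le_eq h4 hj,
    fun j hj => inter_le_eq h5 hj⟩

lemma pat_finite (hfin : ∀ L, {e | e ∈ Bs ∧ (node e).length ≤ L}.Finite) (k : ℕ) :
    (range (pat T node Bs Ψ k)).Finite := by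
  have hl : {s : List Bool | s.length ≤ k}.Finite := List.finite_length_le Bool k
  have hj : {j : ℕ | j ≤ k}.Finite := Set.finite_le_nat k
  refine ((hl.finite_subsets.prod ((hfin k).finite_subsets.prod ((hfin k).finite_subsets.prod
    (hj.finite_subsets.prod hj.finite_subsets))))).subset ?_
  rintro _ ⟨x, rfl⟩
  exact ⟨inter_subset_right, inter_subset_right, inter_subset_right, inter_subset_right,
    inter_subset_right⟩

lemma take_sep (hTd : ∀ i, ∀ s ∈ T i, ∀ k, s.take k ∈ T i) {i j : I} {L : ℕ}
    (h : ∀ s ∈ T i, s ∈ T j → s.length ≠ L) : ∀ s ∈ T i, s ∈ T j → s.length < L := by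
  intro s hi hj
  by_contra hlt
  refine h (s.take L) (hTd i s hi L) (hTd j s hj L) ?_
  simp; omega

theorem oca_split (oca : OCA) (hΨ : HomMod Ψ)
    (hT : ∀ i j, i ≠ j → ∃ L, ∀ s ∈ T i, s ∈ T j → s.length < L)
    (hTinf : ∀ i L, ∃ s ∈ T i, s.length = L)
    (hTd : ∀ i, ∀ s ∈ T i, ∀ k, s.take k ∈ T i)
    (hfin : ∀ L, {e | e ∈ Bs ∧ (node e).length ≤ L}.Finite) :
    ∃ Y : ℕ → Set (X0 T node Bs), (⋃ n, Y n) = univ ∧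
      ∀ n, ∀ x ∈ Y n, ∀ y ∈ Y n, x ≠ y → (x, y) ∉ K0 T node Bs Ψ := by
  have henc : ∀ k, ∃ g : (Set (List Bool) × Set B × Set B × Set ℕ × Set ℕ) → ℕ,
      InjOn g (range (pat T node Bs Ψ k)) := fun k =>
    (Set.countable_iff_exists_injOn).1 (pat_finite hfin k).countable
  choose enc henc using henc
  let code : X0 T node Bs → ℕ → ℕ := fun x k => enc k (pat T node Bs Ψ k x)
  have hcode : ∀ x y k, code x k = code y k → pat T node Bs Ψ k x = pat T node Bs Ψ k y :=
    fun x y k h => henc k (mem_range_self x) (mem_range_self y) h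
  have hinjc : Function.Injective code := by
    intro x y h
    have hp := fun k => pat_spec (hcode x y k (congrFun h k))
    have hi : x.1.1 = y.1.1 := by
      by_contra hne
      obtain ⟨L, hL⟩ := hT _ _ hne
      obtain ⟨s, hs, hsL⟩ := hTinf x.1.1 L
      have := hL s hs (((hp L).1 s hsL.le).1 hs)
      omega
    have h1 : x.1.2.2 = y.1.2.2 := by
      ext e
      constructor
      · intro he; exact ((hp _).2.2.1 e (x.2.2 he).1 le_rfl).1 he
      · intro he; exact ((hp _).2.2.1 e (y.2.2 he).1 le_rfl).2 he
    have h2 : x.1.2.1 = y.1.2.1 := by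
      ext e
      constructor
      · intro he; exact ((hp _).2.1 e (x.2.2 (x.2.1 he)).1 le_rfl).1 he
      · intro he; exact ((hp _).2.1 e (y.2.2 (y.2.1 he)).1 le_rfl).2 he
    exact Subtype.ext (Prod.ext hi (Prod.ext h2 h1))
  letI : TopologicalSpace (X0 T node Bs) := TopologicalSpace.induced code inferInstance
  have hemb : Topology.IsEmbedding code := ⟨⟨rfl⟩, hinjc⟩
  haveI : SecondCountableTopology (X0 T node Bs) := hemb.secondCountableTopology
  haveI : TopologicalSpace.MetrizableSpace (X0 T node Bs) := hemb.metrizableSpace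
  letI : MetricSpace (X0 T node Bs) := TopologicalSpace.metrizableSpaceMetric _
  have hopen : IsOpen (K0 T node Bs Ψ) := by
    rw [isOpen_iff_mem_nhds]
    rintro ⟨x, y⟩ ⟨hne, heq, hnq⟩
    obtain ⟨L, hL⟩ := hT _ _ hne
    have : ∃ j, ¬ (j ∈ Ψ x.1.2.1 ∩ Ψ y.1.2.2 ↔ j ∈ Ψ y.1.2.1 ∩ Ψ x.1.2.2) := by
      by_contra hno
      push Not at hno
      exact hnq (Set.ext hno)
    obtain ⟨j, hj⟩ := this
    have nb : ∀ z : X0 T node Bs, ∀ k, ∀ᶠ z' in 𝓝 z, pat T node Bs Ψ k z' = pat T node Bs Ψ k z := by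
      intro z k
      have ho : IsOpen (code ⁻¹' ((fun f : ℕ → ℕ => f k) ⁻¹' {code z k})) :=
        (((isOpen_discrete {code z k}).preimage (continuous_apply k))).preimage hemb.continuous
      filter_upwards [ho.mem_nhds rfl] with z' hz'
      exact hcode _ _ _ hz'
    rw [nhds_prod_eq]
    filter_upwards [(nb x (max L j)).prod_mk (nb y (max L j))] with ⟨x', y'⟩ ⟨hx, hy⟩
    dsimp only at hx hy
    obtain ⟨x1, x2, x3, x4, x5⟩ := pat_spec hx
    obtain ⟨y1, y2, y3, y4, y5⟩ := pat_spec hy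
    have lL : L ≤ max L j := le_max_left _ _
    have lj : j ≤ max L j := le_max_right _ _
    have hcom : ∀ s ∈ T x'.1.1, s ∈ T y'.1.1 → s.length < L := by
      apply take_sep hTd
      intro s h1 h2 h3
      have := hL s ((x1 s (by omega)).1 h1) ((y1 s (by omega)).1 h2)
      omega
    refine ⟨?_, ?_, ?_⟩
    · intro heq
      obtain ⟨s, hs, hsL⟩ := hTinf x'.1.1 L
      have := hcom s hs (heq ▸ hs)
      omega
    · ext e
      constructor
      · rintro ⟨h1, h2⟩
        have p1 := x'.2.2 (x'.2.1 h1)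
        have p2 := y'.2.2 h2
        have le := (hcom _ p1.2 p2.2).le.trans lL
        have : e ∈ x.1.2.1 ∩ y.1.2.2 := ⟨(x2 e p1.1 le).1 h1, (y3 e p1.1 le).1 h2⟩
        rw [heq] at this
        exact ⟨(y2 e p1.1 le).2 this.1, (x3 e p1.1 le).2 this.2⟩
      · rintro ⟨h1, h2⟩
        have p1 := x'.2.2 h2
        have p2 := y'.2.2 (y'.2.1 h1)
        have le := (hcom _ p1.2 p2.2).le.trans lL
        have : e ∈ y.1.2.1 ∩ x.1.2.2 := ⟨(y2 e p1.1 le).1 h1, (x3 e p1.1 le).1 h2⟩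
        rw [← heq] at this
        exact ⟨(x2 e p1.1 le).2 this.1, (y3 e p1.1 le).2 this.2⟩
    · intro heq'
      apply hj
      have : j ∈ Ψ x'.1.2.1 ∩ Ψ y'.1.2.2 ↔ j ∈ Ψ y'.1.2.1 ∩ Ψ x'.1.2.2 := by
        have h := heq'
        dsimp only at h
        rw [h]
      simp only [mem_inter_iff, x4 j lj, y5 j lj, y4 j lj, x5 j lj] at this
      exact this
  rcases oca (X0 T node Bs) (K0 T node Bs Ψ) hopen
    (fun x y h => ⟨h.1.symm, h.2.1.symm, h.2.2.symm⟩) (fun x h => h.1 rfl) with ⟨Y, hY, hYK⟩ | h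
  · exfalso
    let D : Set B := ⋃ x ∈ Y, x.1.2.1
    have hD : ∀ x ∈ Y, D ∩ x.1.2.2 = x.1.2.1 := by
      intro x hx
      ext e
      constructor
      · rintro ⟨h1, h2⟩
        simp only [D, mem_iUnion] at h1
        obtain ⟨y, hy, he⟩ := h1
        by_cases hxy : x = y
        · subst hxy; exact he
        · have := (hYK x hx y hy hxy).2.1
          dsimp only at this
          have h3 : e ∈ y.1.2.1 ∩ x.1.2.2 := ⟨he, h2⟩
          rw [← this] at h3
          exact h3.1
      · intro he
        exact ⟨mem_biUnion hx he, x.2.1 he⟩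
    have hm : ∀ x : X0 T node Bs, ∃ m, x ∈ Y → ∀ j ≥ m, (j ∈ Ψ x.1.2.1 ↔ j ∈ Ψ D ∩ Ψ x.1.2.2) := by
      intro x
      by_cases hx : x ∈ Y
      · have := hΨ.inter D x.1.2.2
        rw [hD x hx] at this
        obtain ⟨m, hm⟩ := eventually_atTop.1 this
        exact ⟨m, fun _ => hm⟩
      · exact ⟨0, fun h => absurd h hx⟩
    choose m hm using hm
    apply hY
    have hmaps : MapsTo (fun x => (m x, code x (m x))) Y (univ : Set (ℕ × ℕ)) := fun _ _ => trivial
    refine hmaps.countable_of_injOn ?_ (Set.to_countable _)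
    intro x hx y hy hxy
    by_contra hne
    simp only [Prod.mk.injEq] at hxy
    obtain ⟨e1, e2⟩ := hxy
    rw [← e1] at e2
    obtain ⟨-, -, -, p4, p5⟩ := pat_spec (hcode _ _ _ e2)
    refine (hYK x hx y hy hne).2.2 ?_
    dsimp only
    ext j
    rcases le_or_gt j (m x) with hj | hj
    · simp only [mem_inter_iff, p4 j hj, p5 j hj]
    · simp only [mem_inter_iff, hm x hx j hj.le, hm y hy j (e1 ▸ hj.le)]
      tauto
  · exact h

theorem oca_core [Countable B] (hI : ¬ Countable I) (oca : OCA) (hΨ : HomMod Ψ)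
    (hT : ∀ i j, i ≠ j → ∃ L, ∀ s ∈ T i, s ∈ T j → s.length < L)
    (hTinf : ∀ i L, ∃ s ∈ T i, s.length = L)
    (hTd : ∀ i, ∀ s ∈ T i, ∀ k, s.take k ∈ T i)
    (hfin : ∀ L, {e | e ∈ Bs ∧ (node e).length ≤ L}.Finite) :
    ∃ i : I, ∀ E : ℕ → Set B, (∀ k, E k ⊆ bb T node Bs i) →
      (∀ k k', k ≠ k' → Disjoint (E k) (E k')) → ∃ k, CA Ψ (E k) := by
  obtain ⟨Y, hYu, hYK⟩ := oca_split (T := T) (node := node) (Bs := Bs) (Ψ := Ψ) oca hΨ hT hTinf hTd hfin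
  have hden : ∀ n, ∃ D ⊆ Y n, D.Countable ∧ ∀ x ∈ Y n, ∀ k, ∃ y ∈ D,
      pat T node Bs Ψ k y = pat T node Bs Ψ k x := by
    intro n
    have : ∀ k, ∃ D ⊆ Y n, D.Countable ∧ ∀ x ∈ Y n, ∃ y ∈ D,
        pat T node Bs Ψ k y = pat T node Bs Ψ k x := by
      intro k
      have hf : (pat T node Bs Ψ k '' Y n).Finite :=
        (pat_finite hfin k).subset (image_subset_range _ _)
      obtain ⟨D, hD1, hD2⟩ := Set.SurjOn.exists_bijOn_subset (Set.surjOn_image (pat T node Bs Ψ k) (Y n))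
      refine ⟨D, hD1, ?_, fun x hx => ?_⟩
      · exact (hD2.finite_iff_finite.2 hf).countable
      · obtain ⟨y, hy, hy'⟩ := hD2.surjOn (mem_image_of_mem _ hx)
        exact ⟨y, hy, hy'⟩
    choose D h1 h2 h3 using this
    refine ⟨⋃ k, D k, iUnion_subset h1, countable_iUnion h2, fun x hx k => ?_⟩
    obtain ⟨y, hy, hy'⟩ := h3 k x hx
    exact ⟨y, mem_iUnion.2 ⟨k, hy⟩, hy'⟩
  choose D hDY hDc hDd using hden
  obtain ⟨i, hi⟩ : ∃ i : I, ∀ n, ∀ y ∈ D n, y.1.1 ≠ i := by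
    by_contra hno
    push Not at hno
    apply hI
    have hc : (⋃ n, (fun y : X0 T node Bs => y.1.1) '' D n).Countable :=
      countable_iUnion fun n => (hDc n).image _
    rw [← Set.countable_univ_iff]
    refine hc.mono fun i _ => ?_
    obtain ⟨n, y, hy, rfl⟩ := hno i
    exact mem_iUnion.2 ⟨n, y, hy, rfl⟩
  refine ⟨i, ?_⟩
  have hstep : ∀ k, ∃ k', k < k' ∧ ∀ n ≤ k, ∀ x ∈ Y n, x.1.1 = i → ∃ y ∈ D n,
      pat T node Bs Ψ k y = pat T node Bs Ψ k x ∧ ∀ s ∈ T i, s ∈ T y.1.1 → s.length < k' := by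
    intro k
    have h1 : ∀ q ∈ range (pat T node Bs Ψ k) ×ˢ Set.Iic k, ∃ L, ∀ x ∈ Y q.2, x.1.1 = i →
        pat T node Bs Ψ k x = q.1 → ∃ y ∈ D q.2,
        pat T node Bs Ψ k y = pat T node Bs Ψ k x ∧ ∀ s ∈ T i, s ∈ T y.1.1 → s.length < L := by
      rintro ⟨v, n⟩ _
      by_cases hx : ∃ x ∈ Y n, pat T node Bs Ψ k x = v
      · obtain ⟨x, hx, rfl⟩ := hx
        obtain ⟨y, hy, hy'⟩ := hDd n x hx k
        obtain ⟨L, hL⟩ := hT i y.1.1 (hi n y hy).symm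
        refine ⟨L, fun x' hx' _ hxx => ⟨y, hy, hy'.trans hxx.symm, hL⟩⟩
      · exact ⟨0, fun x' hx' _ hxx => absurd ⟨x', hx', hxx⟩ hx⟩
    choose! L hL using h1
    have hf : (range (pat T node Bs Ψ k) ×ˢ Set.Iic k).Finite :=
      (pat_finite hfin k).prod (Set.finite_Iic k)
    obtain ⟨M, hM⟩ := (hf.image L).bddAbove
    refine ⟨max (k + 1) M, by omega, fun n hn x hx hxi => ?_⟩
    have hq : (pat T node Bs Ψ k x, n) ∈ range (pat T node Bs Ψ k) ×ˢ Set.Iic k :=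
      ⟨mem_range_self x, hn⟩
    obtain ⟨y, hy, hy1, hy2⟩ := hL _ hq x hx hxi rfl
    refine ⟨y, hy, hy1, fun s hs hs' => ?_⟩
    have := hM (mem_image_of_mem L hq)
    have := hy2 s hs hs'
    omega
  choose nx hnx1 hnx2 using hstep
  let κ : ℕ → ℕ := fun t => Nat.rec 0 (fun _ k => nx k) t
  have hκs : ∀ t, κ (t + 1) = nx (κ t) := fun t => rfl
  have hκm : StrictMono κ := strictMono_nat_of_lt_succ fun t => hnx1 (κ t)
  have sparse : ∀ b ⊆ bb T node Bs i,
      (∀ M, ∃ t ≥ M, ∀ e ∈ b, (node e).length < κ (t + 1) → (node e).length < κ t) →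
      ∀ E : ℕ → Set B, (∀ k, E k ⊆ b) → (∀ k k', k ≠ k' → Disjoint (E k) (E k')) →
      ∃ k, CA Ψ (E k) := by
    intro b hb hsp E hE hdis
    let F : ℕ → Set B → Set ℕ := fun n a => {j | ∃ y ∈ D n, a ∩ y.1.2.2 = y.1.2.1 ∩ b ∧
      j ∈ Ψ b ∧ j ∈ Ψ y.1.2.2 ∧ j ∈ Ψ y.1.2.1}
    let Fc : ℕ → Set B → Set ℕ := fun n a => {j | ∃ y ∈ D n, a ∩ y.1.2.2 = y.1.2.1 ∩ b ∧
      j ∈ Ψ b ∧ j ∈ Ψ y.1.2.2 ∧ j ∉ Ψ y.1.2.1}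
    have fin : ∀ n, ∀ y ∈ D n, (y.1.2.2 ∩ b).Finite := by
      intro n y hy
      obtain ⟨L, hL⟩ := hT _ _ (hi n y hy)
      refine (hfin L).subset ?_
      rintro e ⟨h1, h2⟩
      exact ⟨(hb h2).1, (hL _ (y.2.2 h1).2 (hb h2).2).le⟩
    have agree : ∀ (d a a' : Set B), a ⊆ b → a' ⊆ b → (∀ c ∈ d ∩ b, c ∈ a' ↔ c ∈ a) →
        a' ∩ d = a ∩ d := by
      intro d a a' ha ha' h
      ext c
      constructor
      · rintro ⟨h1, h2⟩; exact ⟨(h c ⟨h2, ha' h1⟩).1 h1, h2⟩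
      · rintro ⟨h1, h2⟩; exact ⟨(h c ⟨h2, ha h1⟩).2 h1, h2⟩
    have hnot : ∀ n x, x ∈ Y n → x.1.1 = i → ∀ y ∈ D n,
        x.1.2.1 ∩ y.1.2.2 = y.1.2.1 ∩ x.1.2.2 → Ψ x.1.2.1 ∩ Ψ y.1.2.2 = Ψ y.1.2.1 ∩ Ψ x.1.2.2 := by
      intro n x hx hxi y hy h
      by_contra hne
      have hd : x.1.1 ≠ y.1.1 := by rw [hxi]; exact (hi n y hy).symm
      exact hYK n x hx y (hDY n hy) (fun h => hd (h ▸ rfl)) ⟨hd, h, hne⟩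
    refine desc hΨ b E hE hdis F Fc ?_ ?_ ?_
    · rintro n j a ha ⟨y, hy, h1, h2⟩
      refine ⟨y.1.2.2 ∩ b, fin n y hy, fun a' ha' hag => ⟨y, hy, ?_, h2⟩⟩
      rw [agree _ a a' ha ha' hag, h1]
    · rintro n j a ha ⟨y, hy, h1, h2⟩
      refine ⟨y.1.2.2 ∩ b, fin n y hy, fun a' ha' hag => ⟨y, hy, ?_, h2⟩⟩
      rw [agree _ a a' ha ha' hag, h1]
    · intro a ha
      let x : X0 T node Bs := ⟨(i, a, b), ha, hb⟩
      have hx : x ∈ ⋃ n, Y n := by rw [hYu]; trivial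
      obtain ⟨n, hn⟩ := mem_iUnion.1 hx
      have key : ∀ j, ∃ y ∈ D n, a ∩ y.1.2.2 = y.1.2.1 ∩ b ∧
          (j ∈ Ψ y.1.2.2 ↔ j ∈ Ψ b) ∧ (j ∈ Ψ y.1.2.1 ↔ j ∈ Ψ a) := by
        intro j
        obtain ⟨t, ht, hsp⟩ := hsp (max n j)
        have htt : t ≤ κ t := hκm.le_apply
        obtain ⟨y, hy, hy1, hy2⟩ := hnx2 (κ t) n (by omega) x hn rfl
        obtain ⟨-, p2, p3, p4, p5⟩ := pat_spec hy1
        refine ⟨y, hy, ?_, p5 j (by omega), p4 j (by omega)⟩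
        ext e
        constructor
        · rintro ⟨h1, h2⟩
          have hlt := hsp e (ha h1) (hy2 _ (hb (ha h1)).2 (y.2.2 h2).2)
          exact ⟨(p2 e (y.2.2 h2).1 hlt.le).2 h1, ha h1⟩
        · rintro ⟨h1, h2⟩
          have h3 := y.2.1 h1
          have hlt := hsp e h2 (hy2 _ (hb h2).2 (y.2.2 h3).2)
          exact ⟨(p2 e (y.2.2 h3).1 hlt.le).1 h1, h3⟩
      refine ⟨n, ?_, ?_⟩
      · ext j
        constructor
        · rintro ⟨y, hy, h1, h2, h3, h4⟩
          have := hnot n x hn rfl y hy h1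
          have h5 : j ∈ Ψ y.1.2.1 ∩ Ψ x.1.2.2 := ⟨h4, h2⟩
          rw [← this] at h5
          exact ⟨h5.1, h2⟩
        · rintro ⟨h1, h2⟩
          obtain ⟨y, hy, q1, q2, q3⟩ := key j
          exact ⟨y, hy, q1, h2, q2.2 h2, q3.2 h1⟩
      · ext j
        constructor
        · rintro ⟨y, hy, h1, h2, h3, h4⟩
          refine ⟨h2, fun h => ?_⟩
          have := hnot n x hn rfl y hy h1
          have h5 : j ∈ Ψ x.1.2.1 ∩ Ψ y.1.2.2 := ⟨h, h3⟩
          rw [this] at h5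
          exact h4 h5.1
        · rintro ⟨h1, h2⟩
          obtain ⟨y, hy, q1, q2, q3⟩ := key j
          exact ⟨y, hy, q1, h1, q2.2 h1, fun h => h2 (q3.1 h)⟩
  intro E hE hdis
  let b0 : Set B := {e | e ∈ bb T node Bs i ∧ ∃ t, κ (2 * t) ≤ (node e).length ∧
    (node e).length < κ (2 * t + 1)}
  let b1 : Set B := {e | e ∈ bb T node Bs i ∧ ¬ ∃ t, κ (2 * t) ≤ (node e).length ∧
    (node e).length < κ (2 * t + 1)}
  have s0 := sparse b0 (fun e he => he.1) (fun M => ⟨2 * M + 1, by omega, by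
    rintro e ⟨-, t, h1, h2⟩ h3
    have l1 : 2 * t < 2 * M + 1 + 1 := hκm.lt_iff_lt.1 (h1.trans_lt h3)
    have l2 : 2 * t + 1 ≤ 2 * M + 1 := by omega
    have l3 : κ (2 * t + 1) ≤ κ (2 * M + 1) := hκm.monotone l2
    exact h2.trans_le l3⟩)
  have s1 := sparse b1 (fun e he => he.1) (fun M => ⟨2 * M, by omega, by
    rintro e ⟨-, h1⟩ h3
    by_contra h4
    exact h1 ⟨M, not_lt.1 h4, h3⟩⟩)
  have finbad : ∀ b, (∀ E : ℕ → Set B, (∀ k, E k ⊆ b) →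
      (∀ k k', k ≠ k' → Disjoint (E k) (E k')) → ∃ k, CA Ψ (E k)) →
      {k | ¬ CA Ψ (E k ∩ b)}.Finite := by
    intro b hb
    by_contra hinf
    have hinf : {k | ¬ CA Ψ (E k ∩ b)}.Infinite := hinf
    let g := hinf.natEmbedding
    obtain ⟨k, hk⟩ := hb (fun k => E (g k) ∩ b) (fun k => inter_subset_right) (fun k k' hne =>
      (hdis _ _ (fun h => hne (g.injective (Subtype.ext h)))).mono inter_subset_left inter_subset_left)
    exact (g k).2 hk
  have hfb := (finbad b0 s0).union (finbad b1 s1)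
  obtain ⟨k, hk⟩ := hfb.infinite_compl.nonempty
  simp only [mem_compl_iff, mem_union, mem_ofPred_eq, not_or, not_not] at hk
  have hu : CA Ψ (E k ∩ b0 ∪ E k ∩ b1) := CA.union hΨ hk.1 hk.2
  refine ⟨k, hu.mono ?_⟩
  intro e he
  rcases Classical.em (∃ t, κ (2 * t) ≤ (node e).length ∧ (node e).length < κ (2 * t + 1))
    with h | h
  · have h0 : e ∈ b0 := ⟨hE k he, h⟩
    exact Or.inl ⟨he, h0⟩
  · have h0 : e ∈ b1 := ⟨hE k he, h⟩
    exact Or.inr ⟨he, h0⟩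

end OcaCore



section Groups

lemma exists_compact_ctbl {Z : Set Cant} (hZ : ¬ Z.Countable) :
    ∃ C ⊆ Z, IsCompact C ∧ C.Countable ∧ C.Infinite := by
  have hnd : ¬ DiscreteTopology Z := by
    intro hd
    apply hZ
    have : Countable Z := TopologicalSpace.separableSpace_iff_countable.1 inferInstance
    exact this
  have : ∃ z : Z, ¬ IsOpen ({z} : Set Z) := by
    by_contra h
    push Not at h
    exact hnd (discreteTopology_iff_isOpen_singleton.2 h)
  obtain ⟨z, hz⟩ := this
  have hcl : z ∈ closure ({z}ᶜ : Set Z) := by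
    by_contra h
    apply hz
    have h2 : closure ({z}ᶜ : Set Z) = {z}ᶜ := by
      apply Subset.antisymm
      · intro w hw hwz
        rw [mem_singleton_iff] at hwz
        exact h (hwz ▸ hw)
      · exact subset_closure
    have h3 : IsClosed ({z}ᶜ : Set Z) := h2 ▸ isClosed_closure
    simpa using h3.isOpen_compl
  obtain ⟨u, hu, hlim⟩ := mem_closure_iff_seq_limit.1 hcl
  refine ⟨(↑) '' (insert z (range u)), ?_, ?_, ?_, ?_⟩
  · rintro _ ⟨w, -, rfl⟩
    exact w.2
  · exact hlim.isCompact_insert_range.image continuous_subtype_val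
  · exact ((countable_range u).insert z).image _
  · refine Set.Infinite.image Subtype.val_injective.injOn ?_
    intro hf
    have hfr : (range u).Finite := hf.subset (subset_insert _ _)
    have := hfr.isClosed.mem_of_tendsto hlim (Eventually.of_forall fun n => mem_range_self n)
    obtain ⟨n, hn⟩ := this
    exact hu n hn

lemma exists_family {Z : Set Cant} (hZ : ¬ Z.Countable) :
    ∃ F : Set (Set Cant), ¬ F.Countable ∧ (∀ C ∈ F, ∀ C' ∈ F, C ≠ C' → Disjoint C C') ∧
      ∀ C ∈ F, C ⊆ Z ∧ IsCompact C ∧ C.Countable ∧ C.Infinite := by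
  obtain ⟨F, hF⟩ := zorn_subset {F : Set (Set Cant) |
      (∀ C ∈ F, ∀ C' ∈ F, C ≠ C' → Disjoint C C') ∧
      ∀ C ∈ F, C ⊆ Z ∧ IsCompact C ∧ C.Countable ∧ C.Infinite} (by
    intro c hc hch
    refine ⟨⋃₀ c, ⟨?_, ?_⟩, fun s hs => subset_sUnion_of_mem hs⟩
    · rintro C ⟨s, hs, hCs⟩ C' ⟨s', hs', hCs'⟩ hne
      rcases hch.total hs hs' with h | h
      · exact (hc hs').1 C (h hCs) C' hCs' hne
      · exact (hc hs).1 C hCs C' (h hCs') hne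
    · rintro C ⟨s, hs, hCs⟩
      exact (hc hs).2 C hCs)
  refine ⟨F, ?_, hF.1.1, hF.1.2⟩
  intro hFc
  have hU : (⋃₀ F).Countable := hFc.sUnion fun C hC => (hF.1.2 C hC).2.2.1
  have hZ' : ¬ (Z \ ⋃₀ F).Countable := by
    intro h
    apply hZ
    refine (h.union hU).mono ?_
    intro x hx
    by_cases hxF : x ∈ ⋃₀ F
    · exact Or.inr hxF
    · exact Or.inl ⟨hx, hxF⟩
  obtain ⟨C, hCZ, h1, h2, h3⟩ := exists_compact_ctbl hZ'
  have hdisj : ∀ C' ∈ F, Disjoint C C' := by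
    intro C' hC'
    rw [Set.disjoint_left]
    intro x hx hx'
    exact (hCZ hx).2 ⟨C', hC', hx'⟩
  have hmem : C ∈ F := by
    refine hF.2 (y := insert C F) ⟨?_, ?_⟩ (subset_insert _ _) (mem_insert _ _)
    · intro D hD D' hD' hne
      rcases hD with rfl | hD <;> rcases hD' with rfl | hD'
      · exact absurd rfl hne
      · exact hdisj _ hD'
      · exact (hdisj _ hD).symm
      · exact hF.1.1 _ hD _ hD' hne
    · intro D hD
      rcases hD with rfl | hD
      · exact ⟨fun x hx => (hCZ hx).1, h1, h2, h3⟩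
      · exact hF.1.2 _ hD
  obtain ⟨x, hx⟩ := h3.nonempty
  exact (hCZ hx).2 ⟨C, hmem, hx⟩

/-- initial segment of `c` of length `k` -/
def pre (c : Cant) (k : ℕ) : List Bool := List.ofFn fun i : Fin k => c i.1

lemma pre_length (c : Cant) (k : ℕ) : (pre c k).length = k := by simp [pre]

lemma pre_take (c : Cant) (k l : ℕ) : (pre c k).take l = pre c (min l k) := by
  apply List.ext_getElem
  · simp [pre]
  · intro i h1 h2
    simp [pre]

lemma pre_eq {c c' : Cant} {k k' : ℕ} (h : pre c k = pre c' k') :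
    k = k' ∧ ∀ i < k, c i = c' i := by
  have hk : k = k' := by rw [← pre_length c k, h, pre_length]
  subst hk
  refine ⟨rfl, fun i hi => ?_⟩
  have := List.getElem_of_eq h (i := i) (by simpa [pre_length] using hi)
  simpa [pre] using this

lemma compact_sep {C C' : Set Cant} (hC : IsCompact C) (hC' : IsCompact C')
    (hd : Disjoint C C') : ∃ L, ∀ c ∈ C, ∀ c' ∈ C', ∃ i < L, c i ≠ c' i := by
  have hK := hC.prod hC'
  obtain ⟨L, hL⟩ := hK.elim_directed_cover (fun L : ℕ => {p : Cant × Cant | ∃ i < L, p.1 i ≠ p.2 i})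
    (by
      intro L
      have : {p : Cant × Cant | ∃ i < L, p.1 i ≠ p.2 i} =
          ⋃ i ∈ Iio L, {p : Cant × Cant | p.1 i = p.2 i}ᶜ := by
        ext p; simp
      rw [this]
      refine isOpen_biUnion fun i _ => ?_
      refine (isClosed_eq ?_ ?_).isOpen_compl <;> fun_prop)
    (by
      rintro ⟨c, c'⟩ ⟨h1, h2⟩
      have hne : c ≠ c' := fun h => Set.disjoint_left.1 hd h1 (h ▸ h2)
      obtain ⟨i, hi⟩ := Function.ne_iff.1 hne
      exact mem_iUnion.2 ⟨i + 1, i, Nat.lt_succ_self i, hi⟩)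
    (by
      intro a b
      refine ⟨max a b, ?_, ?_⟩
      · rintro p ⟨i, hi, h⟩
        exact ⟨i, lt_of_lt_of_le hi (le_max_left _ _), h⟩
      · rintro p ⟨i, hi, h⟩
        exact ⟨i, lt_of_lt_of_le hi (le_max_right _ _), h⟩)
  exact ⟨L, fun c hc c' hc' => hL (show (c, c') ∈ C ×ˢ C' from ⟨hc, hc'⟩)⟩

theorem groups {B : Type} [Countable B] {Ψ : Set B → Set ℕ} {node : B → List Bool} {Bs : Set B}
    (oca : OCA) (hΨ : HomMod Ψ)
    (hfin : ∀ L, {e | e ∈ Bs ∧ (node e).length ≤ L}.Finite)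
    (Z : Set Cant) (hZ : ∀ z ∈ Z, ¬ CA Ψ {e | e ∈ Bs ∧ ∃ k, node e = pre z k}) :
    Z.Countable := by
  by_contra hunc
  obtain ⟨F, hFu, hFd, hF⟩ := exists_family hunc
  have hI : ¬ Countable F := hFu
  obtain ⟨C, hC⟩ := oca_core (I := F) (T := fun C => {s | ∃ c ∈ C.1, ∃ k, s = pre c k})
    (node := node) (Bs := Bs) hI oca hΨ
    (by
      intro C C' hne
      obtain ⟨L, hL⟩ := compact_sep (hF _ C.2).2.1 (hF _ C'.2).2.1
        (hFd _ C.2 _ C'.2 (fun h => hne (Subtype.ext h)))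
      refine ⟨L, ?_⟩
      rintro s ⟨c, hc, k, rfl⟩ ⟨c', hc', k', h⟩
      obtain ⟨i, hi, hne⟩ := hL c hc c' hc'
      rw [pre_length]
      by_contra hle
      exact hne ((pre_eq h).2 i (by omega)))
    (by
      intro C L
      obtain ⟨c, hc⟩ := (hF _ C.2).2.2.2.nonempty
      exact ⟨pre c L, ⟨c, hc, L, rfl⟩, pre_length _ _⟩)
    (by
      rintro C s ⟨c, hc, k, rfl⟩ l
      exact ⟨c, hc, _, pre_take _ _ _⟩)
    hfin
  let g := (hF _ C.2).2.2.2.natEmbedding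
  let P : ℕ → Set B := fun k => {e | e ∈ Bs ∧ ∃ l, node e = pre (g k).1 l}
  have hPfin : ∀ k k', k ≠ k' → (P k ∩ P k').Finite := by
    intro k k' hne
    have hne' : (g k).1 ≠ (g k').1 := fun h => hne (g.injective (Subtype.ext h))
    obtain ⟨i, hi⟩ := Function.ne_iff.1 hne'
    refine (hfin i).subset ?_
    rintro e ⟨⟨he, l, hl⟩, -, l', hl'⟩
    refine ⟨he, ?_⟩
    rw [hl, pre_length]
    by_contra hlt
    exact hi ((pre_eq (hl.symm.trans hl')).2 i (by omega))
  obtain ⟨k, hk⟩ := hC (fun k => P k \ ⋃ i ∈ Iio k, P i)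
    (by
      rintro k e ⟨⟨he, l, hl⟩, -⟩
      exact ⟨he, (g k).1, (g k).2, l, hl⟩)
    (by
      have aux : ∀ k k', k < k' → Disjoint (P k \ ⋃ i ∈ Iio k, P i) (P k' \ ⋃ i ∈ Iio k', P i) := by
        intro k k' hlt
        rw [Set.disjoint_left]
        rintro e ⟨h1, -⟩ ⟨-, h2⟩
        exact h2 (mem_biUnion (show k ∈ Iio k' from hlt) h1)
      intro k k' hne
      rcases lt_or_gt_of_ne hne with h | h
      · exact aux _ _ h
      · exact (aux _ _ h).symm)
  have hfinU : (⋃ i ∈ Iio k, P k ∩ P i).Finite :=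
    (Set.finite_Iio k).biUnion fun i hi => hPfin k i (Nat.ne_of_gt hi)
  have hu := CA.union hΨ hk (CA.finite hΨ hfinU)
  refine hZ (g k).1 ((hF _ C.2).1 (g k).2) (hu.mono ?_)
  intro e he
  have he' : e ∈ P k := he
  by_cases h : e ∈ ⋃ i ∈ Iio k, P i
  · right
    obtain ⟨i, hi, hei⟩ := mem_iUnion₂.1 h
    exact mem_biUnion hi ⟨he', hei⟩
  · exact Or.inl ⟨he', h⟩

end Groups



section Final

/-- a representative of a class in `P(ℕ)/fin` -/
noncomputable def rep (x : PFin ℕ) : Set ℕ := Quotient.out x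

lemma mk_rep (x : PFin ℕ) : PFin.mk (rep x) = x := Quotient.out_eq x

lemma aeq_iff {X Y : Set ℕ} : PFin.mk X = PFin.mk Y ↔ AEq X Y := by
  have h1 : PFin.mk X = PFin.mk Y ↔ (symmDiff X Y).Finite :=
    ⟨fun h => Quotient.exact h, fun h => Quotient.sound h⟩
  rw [h1, AEq, ← Nat.cofinite_eq_atTop, Filter.eventually_cofinite]
  have : symmDiff X Y = {x | ¬ (x ∈ X ↔ x ∈ Y)} := by
    ext x
    rw [Set.mem_symmDiff]
    show _ ↔ ¬ (x ∈ X ↔ x ∈ Y)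
    tauto
  rw [this]

lemma mem_cyl_iff {s : List Bool} {x : Cant} : x ∈ cyl s ↔ ∀ i b, s[i]? = some b → x i = b := by
  constructor
  · intro h i b hb
    obtain ⟨hi, rfl⟩ := List.getElem?_eq_some_iff.1 hb
    exact h ⟨i, hi⟩
  · intro h i
    exact h i.1 _ (by simp)

lemma mem_basic_iff {n : ℕ} {s : List Bool} {p : CSp} :
    p ∈ basic n s ↔ p.1 = n ∧ p.2 ∈ cyl s := by
  simp [basic]

lemma prefix_get {s t : List Bool} (h : s <+: t) {i : ℕ} {b : Bool} (hs : s[i]? = some b) :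
    t[i]? = some b := by
  obtain ⟨r, rfl⟩ := h
  obtain ⟨hi, -⟩ := List.getElem?_eq_some_iff.1 hs
  rw [List.getElem?_append_left hi, hs]

lemma cyl_mono {s t : List Bool} (h : s <+: t) : cyl t ⊆ cyl s := by
  intro x hx
  rw [mem_cyl_iff] at hx ⊢
  intro i b hb
  exact hx i b (prefix_get h hb)

/-- a canonical point of a cylinder -/
def pt (s : List Bool) : Cant := fun i => (s[i]?).getD false

lemma pt_mem (s : List Bool) : pt s ∈ cyl s := by
  rw [mem_cyl_iff]
  intro i b h
  simp [pt, h]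

lemma prefix_of_mem {s t : List Bool} {x : Cant} (hs : x ∈ cyl s) (ht : x ∈ cyl t)
    (hl : s.length ≤ t.length) : s <+: t := by
  rw [List.prefix_iff_eq_take]
  apply List.ext_getElem?
  intro i
  by_cases hi : i < s.length
  · rw [List.getElem?_take_of_lt hi]
    have h1 := mem_cyl_iff.1 hs i _ (List.getElem?_eq_getElem hi)
    have h2 := mem_cyl_iff.1 ht i _ (List.getElem?_eq_getElem (hi.trans_le hl))
    rw [List.getElem?_eq_getElem hi, List.getElem?_eq_getElem (hi.trans_le hl), ← h1, ← h2]
  · rw [List.getElem?_eq_none (by omega), List.getElem?_eq_none (by simp; omega)]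

lemma eq_of_mem {s t : List Bool} {x : Cant} (hs : x ∈ cyl s) (ht : x ∈ cyl t)
    (hl : s.length = t.length) : s = t :=
  (prefix_of_mem hs ht hl.le).eq_of_length hl

lemma mem_cyl_append {s : List Bool} {b : Bool} {x : Cant} :
    x ∈ cyl (s ++ [b]) ↔ x ∈ cyl s ∧ x s.length = b := by
  constructor
  · intro h
    exact ⟨cyl_mono (List.prefix_append _ _) h, mem_cyl_iff.1 h s.length b (by simp)⟩
  · rintro ⟨h1, h2⟩
    rw [mem_cyl_iff] at h1 ⊢
    intro i c hc
    rcases lt_trichotomy i s.length with hi | hi | hi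
    · rw [List.getElem?_append_left hi] at hc
      exact h1 i c hc
    · subst hi
      simp at hc
      rw [h2, hc]
    · rw [List.getElem?_eq_none (by simp; omega)] at hc
      exact absurd hc (by simp)

lemma trich (s t : List Bool) : s <+: t ∨ t <+: s ∨
    ∃ i b c, s.take i = t.take i ∧ s[i]? = some b ∧ t[i]? = some c ∧ b ≠ c := by
  induction s generalizing t with
  | nil => exact Or.inl List.nil_prefix
  | cons a s ih =>
    cases t with
    | nil => exact Or.inr (Or.inl List.nil_prefix)
    | cons d t =>
      by_cases had : a = d
      · subst had
        rcases ih t with h | h | ⟨i, b, c, h1, h2, h3, h4⟩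
        · exact Or.inl (by simpa using h)
        · exact Or.inr (Or.inl (by simpa using h))
        · exact Or.inr (Or.inr ⟨i + 1, b, c, by simpa using h1, by simpa using h2,
            by simpa using h3, h4⟩)
      · exact Or.inr (Or.inr ⟨0, a, d, by simp, by simp, by simp, had⟩)

lemma mem_openSet {O : Set (ℕ × List Bool)} {p : CSp} :
    p ∈ openSet O ↔ ∃ t, (p.1, t) ∈ O ∧ p.2 ∈ cyl t := by
  constructor
  · intro h
    obtain ⟨⟨n, t⟩, hO, hp⟩ := mem_iUnion₂.1 h
    obtain ⟨h1, h2⟩ := mem_basic_iff.1 hp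
    dsimp only at h1 h2
    subst h1
    exact ⟨t, hO, h2⟩
  · rintro ⟨t, hO, h⟩
    exact mem_iUnion₂.2 ⟨_, hO, mem_basic_iff.2 ⟨rfl, h⟩⟩

lemma openSet_single (n : ℕ) (s : List Bool) : openSet {(n, s)} = basic n s := by
  simp [openSet]

lemma openSet_union (X Y : Set (ℕ × List Bool)) : openSet (X ∪ Y) = openSet X ∪ openSet Y := by
  ext p
  simp only [mem_openSet, mem_union]
  grind

lemma openSet_inter {g : ℕ → ℕ} {X Y : Set (ℕ × List Bool)} (hX : X ⊆ Bf g) (hY : Y ⊆ Bf g) :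
    openSet (X ∩ Y) = openSet X ∩ openSet Y := by
  ext p
  simp only [mem_openSet, mem_inter_iff]
  constructor
  · rintro ⟨t, ⟨h1, h2⟩, h3⟩
    exact ⟨⟨t, h1, h3⟩, t, h2, h3⟩
  · rintro ⟨⟨t, h1, h2⟩, t', h1', h2'⟩
    have e1 : t.length = g p.1 := hX h1
    have e2 : t'.length = g p.1 := hY h1'
    have : t = t' := eq_of_mem h2 h2' (e1.trans e2.symm)
    subst this
    exact ⟨t, ⟨h1, h1'⟩, h2⟩

lemma openSet_sdiff {g : ℕ → ℕ} {X Y : Set (ℕ × List Bool)} (hX : X ⊆ Bf g) (hY : Y ⊆ Bf g) :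
    openSet (X \ Y) = openSet X ∩ (openSet Y)ᶜ := by
  ext p
  simp only [mem_openSet, mem_inter_iff, mem_compl_iff, Set.mem_sdiff]
  constructor
  · rintro ⟨t, ⟨h1, h2⟩, h3⟩
    refine ⟨⟨t, h1, h3⟩, ?_⟩
    rintro ⟨t', h1', h2'⟩
    have e1 : t.length = g p.1 := hX h1
    have e2 : t'.length = g p.1 := hY h1'
    have : t = t' := eq_of_mem h3 h2' (e1.trans e2.symm)
    subst this
    exact h2 h1'
  · rintro ⟨⟨t, h1, h2⟩, h3⟩
    exact ⟨t, ⟨h1, fun h => h3 ⟨t, h, h2⟩⟩, h2⟩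

lemma classOf_sup {O X Y : Set (ℕ × List Bool)} (h : openSet O = openSet X ∪ openSet Y) :
    classOf μ O = MAlg.sup (classOf μ X) (classOf μ Y) := by
  show MAlg.mk μ _ = MAlg.mk μ _
  congr 1
  exact Subtype.ext h

lemma classOf_inf {O X Y : Set (ℕ × List Bool)} (h : openSet O = openSet X ∩ openSet Y) :
    classOf μ O = MAlg.inf (classOf μ X) (classOf μ Y) := by
  show MAlg.mk μ _ = MAlg.mk μ _
  congr 1
  exact Subtype.ext h

lemma classOf_infc {O X Y : Set (ℕ × List Bool)} (h : openSet O = openSet X ∩ (openSet Y)ᶜ) :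
    classOf μ O = MAlg.inf (classOf μ X) (MAlg.compl (classOf μ Y)) := by
  show MAlg.mk μ _ = MAlg.mk μ _
  congr 1
  exact Subtype.ext h

lemma mk_union {φ : MAlg μ → PFin ℕ} (hφ : Paper.IsEmbedding μ φ) {O X Y : Set (ℕ × List Bool)}
    {P Q : Set ℕ} (h : openSet O = openSet X ∪ openSet Y) (hP : PFin.mk P = φ (classOf μ X))
    (hQ : PFin.mk Q = φ (classOf μ Y)) : PFin.mk (P ∪ Q) = φ (classOf μ O) := by
  rw [classOf_sup h, hφ.map_sup, ← hP, ← hQ]; rfl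

lemma mk_inter {φ : MAlg μ → PFin ℕ} (hφ : Paper.IsEmbedding μ φ) {O X Y : Set (ℕ × List Bool)}
    {P Q : Set ℕ} (h : openSet O = openSet X ∩ openSet Y) (hP : PFin.mk P = φ (classOf μ X))
    (hQ : PFin.mk Q = φ (classOf μ Y)) : PFin.mk (P ∩ Q) = φ (classOf μ O) := by
  rw [classOf_inf h, hφ.map_inf, ← hP, ← hQ]; rfl

lemma mk_sdiff {φ : MAlg μ → PFin ℕ} (hφ : Paper.IsEmbedding μ φ) {O X Y : Set (ℕ × List Bool)}
    {P Q : Set ℕ} (h : openSet O = openSet X ∩ (openSet Y)ᶜ) (hP : PFin.mk P = φ (classOf μ X))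
    (hQ : PFin.mk Q = φ (classOf μ Y)) : PFin.mk (P ∩ Qᶜ) = φ (classOf μ O) := by
  rw [classOf_infc h, hφ.map_inf, hφ.map_compl, ← hP, ← hQ]; rfl

lemma ev_disj {φ : MAlg μ → PFin ℕ} (hφ : Paper.IsEmbedding μ φ) {X Y : Set (ℕ × List Bool)}
    {P Q : Set ℕ} (h : openSet X ∩ openSet Y = ∅) (hP : PFin.mk P = φ (classOf μ X))
    (hQ : PFin.mk Q = φ (classOf μ Y)) : ∀ᶠ j in atTop, ¬ (j ∈ P ∧ j ∈ Q) := by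
  have h0 : openSet (∅ : Set (ℕ × List Bool)) = openSet X ∩ openSet Y := by
    rw [h]; simp [openSet]
  have h1 := mk_inter hφ h0 hP hQ
  have h2 : classOf μ ∅ = MAlg.bot := by
    show MAlg.mk μ _ = MAlg.mk μ _
    congr 1
    exact Subtype.ext (by simp [openSet])
  rw [h2, hφ.map_bot] at h1
  have h3 : AEq (P ∩ Q) ∅ := aeq_iff.1 h1
  filter_upwards [h3] with j hj hj'
  exact (hj.1 hj')

/-- the induced homomorphism on the layer -/
noncomputable def Psi (φ : MAlg μ → PFin ℕ) (f : ℕ → ℕ) (X : Set (ℕ × List Bool)) : Set ℕ :=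
  rep (φ (classOf μ (X ∩ Bf f)))

lemma homMod_Psi {φ : MAlg μ → PFin ℕ} (hφ : Paper.IsEmbedding μ φ) (f : ℕ → ℕ) :
    HomMod (Psi φ f) := by
  constructor
  · intro X Y
    rw [← aeq_iff]
    have := mk_union hφ (O := (X ∪ Y) ∩ Bf f) (X := X ∩ Bf f) (Y := Y ∩ Bf f) (by
      rw [union_inter_distrib_right, openSet_union]) (mk_rep _) (mk_rep _)
    exact (mk_rep _).trans this.symm
  · intro X Y
    rw [← aeq_iff]
    have := mk_inter hφ (O := (X ∩ Y) ∩ Bf f) (X := X ∩ Bf f) (Y := Y ∩ Bf f) (by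
      rw [← openSet_inter (g := f) inter_subset_right inter_subset_right]
      congr 1
      ext p; simp only [mem_inter_iff]; tauto) (mk_rep _) (mk_rep _)
    exact (mk_rep _).trans this.symm
  · intro X Y
    rw [← aeq_iff]
    have := mk_sdiff hφ (O := (X \ Y) ∩ Bf f) (X := X ∩ Bf f) (Y := Y ∩ Bf f) (by
      rw [← openSet_sdiff (g := f) inter_subset_right inter_subset_right]
      congr 1
      ext p; simp only [mem_inter_iff, Set.mem_sdiff]; tauto) (mk_rep _) (mk_rep _)
    exact (mk_rep _).trans this.symm

end Final



section Lift

lemma basic_split (n : ℕ) (s : List Bool) :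
    basic n s = basic n (s ++ [false]) ∪ basic n (s ++ [true]) := by
  ext p
  simp only [mem_basic_iff, mem_union, mem_cyl_append]
  cases p.2 s.length <;> simp

lemma basic_false (n : ℕ) (s : List Bool) :
    basic n (s ++ [false]) = basic n s ∩ basic n (s ++ [false]) := by
  ext p
  simp only [mem_basic_iff, mem_inter_iff, mem_cyl_append]
  tauto

lemma basic_true (n : ℕ) (s : List Bool) :
    basic n (s ++ [true]) = basic n s ∩ (basic n (s ++ [false]))ᶜ := by
  ext p
  simp only [mem_basic_iff, mem_inter_iff, mem_compl_iff, mem_cyl_append]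
  cases p.2 s.length <;> simp <;> tauto

lemma isClopen_cyl (s : List Bool) : IsClopen (cyl s) := by
  have h : cyl s = ⋂ i : Fin s.length, (fun x : Cant => x i.1) ⁻¹' {s.get i} := by
    ext x; simp [cyl]
  rw [h]
  refine isClopen_iInter_of_finite fun i => ?_
  exact (isClopen_discrete _).preimage (continuous_apply _)

lemma isClopen_basic (n : ℕ) (s : List Bool) : IsClopen (basic n s) :=
  (isClopen_discrete _).prod (isClopen_cyl s)

lemma isOpen_openSet (O : Set (ℕ × List Bool)) : IsOpen (openSet O) :=
  isOpen_biUnion fun p _ => (isClopen_basic _ _).isOpen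

lemma mem_cyl_pre (x : Cant) (k : ℕ) : x ∈ cyl (pre x k) := by
  rw [mem_cyl_iff]
  intro i b h
  obtain ⟨hi, rfl⟩ := List.getElem?_eq_some_iff.1 h
  simp [pre]

lemma isClopen_openSet {g : ℕ → ℕ} {O : Set (ℕ × List Bool)} (hO : O ⊆ Bf g) :
    IsClopen (openSet O) := by
  refine ⟨?_, isOpen_openSet O⟩
  have : openSet O = (openSet (Bf g \ O))ᶜ := by
    have h1 := openSet_sdiff (g := g) (X := Bf g) (Y := O) Subset.rfl hO
    have h2 : openSet (Bf g) = univ := by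
      ext p
      simp only [mem_univ, iff_true]
      exact mem_openSet.2 ⟨pre p.2 (g p.1), pre_length _ _, mem_cyl_pre _ _⟩
    rw [h1, h2, univ_inter, compl_compl]
  rw [this]
  exact (isOpen_openSet _).isClosed_compl

lemma pos_of_open (hμ : IsMeasureOK μ) {U : Set CSp} (hU : IsOpen U) (hz : μ U = 0) : U = ∅ := by
  by_contra hne
  obtain ⟨⟨n, x⟩, hp⟩ := Set.nonempty_iff_ne_empty.2 hne
  have hU' : IsOpen {y : Cant | (n, y) ∈ U} := hU.preimage (by fun_prop)
  obtain ⟨I, u, h1, h2⟩ := isOpen_pi_iff.1 hU' x hp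
  obtain ⟨k, hk⟩ := I.bddAbove
  have hsub : basic n (pre x (k + 1)) ⊆ U := by
    rintro ⟨m, y⟩ hmy
    obtain ⟨hm, hy⟩ := mem_basic_iff.1 hmy
    dsimp only at hm hy
    subst hm
    apply h2
    intro i hi
    have hik : i < k + 1 := Nat.lt_succ_of_le (hk hi)
    have hg : (pre x (k + 1))[i]? = some (x i) := by
      have hl : i < (pre x (k + 1)).length := by rw [pre_length]; exact hik
      rw [List.getElem?_eq_getElem hl]
      simp [pre, -List.ofFn_succ]
    have : y i = x i := mem_cyl_iff.1 hy i (x i) hg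
    rw [this]
    exact (h1 i hi).2
  have h3 := measure_mono_null hsub hz
  rw [hμ] at h3
  have : (2 : ℝ≥0∞)⁻¹ ≠ 0 := by simp
  exact pow_ne_zero _ this h3

lemma clopen_eq (hμ : IsMeasureOK μ) {O O' : Set (ℕ × List Bool)} (h : IsClopen (openSet O))
    (h' : IsClopen (openSet O')) (he : classOf μ O = classOf μ O') : openSet O = openSet O' := by
  have h0 : μ (symmDiff (openSet O) (openSet O')) = 0 := Quotient.exact he
  have h1 : IsOpen (symmDiff (openSet O) (openSet O')) := by
    rw [Set.symmDiff_def]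
    exact (h.isOpen.sdiff h'.isClosed).union (h'.isOpen.sdiff h.isClosed)
  have h2 := pos_of_open hμ h1 h0
  exact symmDiff_eq_bot.1 h2

lemma openSet_inj {g : ℕ → ℕ} {O O' : Set (ℕ × List Bool)} (hO : O ⊆ Bf g) (hO' : O' ⊆ Bf g)
    (h : openSet O = openSet O') : O ⊆ O' := by
  rintro ⟨n, s⟩ hp
  have h1 : ((n, pt s) : CSp) ∈ openSet O := mem_openSet.2 ⟨s, hp, pt_mem s⟩
  rw [h] at h1
  obtain ⟨t, ht, hx⟩ := mem_openSet.1 h1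
  have e1 : s.length = g n := hO hp
  have e2 : t.length = g n := hO' ht
  have := eq_of_mem (pt_mem s) hx (e1.trans e2.symm)
  rw [this]
  exact ht

lemma prefix_of_cyl {s t : List Bool} (h : cyl t ⊆ cyl s) : s <+: t := by
  by_contra hn
  have hlt : t.length < s.length := by
    by_contra hle
    exact hn (prefix_of_mem (h (pt_mem t)) (pt_mem t) (by omega))
  have hts : t <+: s := prefix_of_mem (pt_mem t) (h (pt_mem t)) hlt.le
  have h1 := h (a := fun i => if i < t.length then pt t i else !(pt s i)) (by
    rw [mem_cyl_iff]
    intro i b hb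
    obtain ⟨hi, -⟩ := List.getElem?_eq_some_iff.1 hb
    rw [if_pos hi]
    exact mem_cyl_iff.1 (pt_mem t) i b hb)
  have h2 := mem_cyl_iff.1 h1 t.length _ (List.getElem?_eq_getElem hlt)
  have h3 := mem_cyl_iff.1 (pt_mem s) t.length _ (List.getElem?_eq_getElem hlt)
  rw [if_neg (lt_irrefl _), ← h3] at h2
  simp at h2

lemma basic_inj {n m : ℕ} {s t : List Bool} (h : basic n s = basic m t) : n = m ∧ s = t := by
  have hn : n = m := by
    have h1 : ((n, pt s) : CSp) ∈ basic n s := mem_basic_iff.2 ⟨rfl, pt_mem s⟩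
    rw [h] at h1
    exact (mem_basic_iff.1 h1).1
  subst hn
  have hc : cyl s = cyl t := by
    ext x
    have : ((n, x) : CSp) ∈ basic n s ↔ ((n, x) : CSp) ∈ basic n t := by rw [h]
    simpa [mem_basic_iff] using this
  have p1 := prefix_of_cyl hc.le
  have p2 := prefix_of_cyl hc.ge
  exact ⟨rfl, p2.eq_of_length (le_antisymm p2.length_le p1.length_le)⟩

/-- the values of the lifting on basic sets -/
def VV (R : ℕ → List Bool → Set ℕ) (g : ℕ → ℕ) (K : ℕ × List Bool → Set ℕ) (n : ℕ)
    (s : List Bool) : Set ℕ :=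
  {j | (∃ t, t.length = g n ∧ (s <+: t ∨ t <+: s) ∧ j ∈ K (n, t)) ∧
    ∀ i b, g n ≤ i → s[i]? = some b → (b = false ↔ j ∈ R n (s.take i ++ [false]))}

lemma VV_small {R : ℕ → List Bool → Set ℕ} {g : ℕ → ℕ} {K : ℕ × List Bool → Set ℕ} {n : ℕ}
    {s : List Bool} (h : s.length ≤ g n) {j : ℕ} :
    j ∈ VV R g K n s ↔ ∃ t, t.length = g n ∧ s <+: t ∧ j ∈ K (n, t) := by
  constructor
  · rintro ⟨⟨t, h1, h2 | h2, h3⟩, -⟩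
    · exact ⟨t, h1, h2, h3⟩
    · have : t = s := h2.eq_of_length (le_antisymm h2.length_le (by omega))
      exact ⟨t, h1, by rw [this], h3⟩
  · rintro ⟨t, h1, h2, h3⟩
    refine ⟨⟨t, h1, Or.inl h2, h3⟩, ?_⟩
    intro i b hi hb
    obtain ⟨hi', -⟩ := List.getElem?_eq_some_iff.1 hb
    omega

lemma VV_eq {R : ℕ → List Bool → Set ℕ} {g : ℕ → ℕ} {K : ℕ × List Bool → Set ℕ} {n : ℕ}
    {s : List Bool} (h : s.length = g n) : VV R g K n s = K (n, s) := by
  ext j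
  rw [VV_small h.le]
  constructor
  · rintro ⟨t, h1, h2, h3⟩
    rwa [h2.eq_of_length (h.trans h1.symm)]
  · intro hj
    exact ⟨s, h, List.prefix_rfl, hj⟩

lemma VV_split {R : ℕ → List Bool → Set ℕ} {g : ℕ → ℕ} {K : ℕ × List Bool → Set ℕ} {n : ℕ}
    {s : List Bool} (h : s.length < g n) :
    VV R g K n s = VV R g K n (s ++ [false]) ∪ VV R g K n (s ++ [true]) := by
  ext j
  rw [mem_union, VV_small h.le, VV_small (by simp; omega), VV_small (by simp; omega)]
  constructor
  · rintro ⟨t, h1, ⟨r, rfl⟩, h3⟩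
    cases r with
    | nil => simp at h1; omega
    | cons b r =>
      cases b
      · exact Or.inl ⟨_, h1, ⟨r, by simp⟩, h3⟩
      · exact Or.inr ⟨_, h1, ⟨r, by simp⟩, h3⟩
  · rintro (⟨t, h1, h2, h3⟩ | ⟨t, h1, h2, h3⟩)
    · exact ⟨t, h1, (List.prefix_append _ _).trans h2, h3⟩
    · exact ⟨t, h1, (List.prefix_append _ _).trans h2, h3⟩

lemma VV_big {R : ℕ → List Bool → Set ℕ} {g : ℕ → ℕ} {K : ℕ × List Bool → Set ℕ} {n : ℕ}
    {s : List Bool} {b : Bool} (h : g n ≤ s.length) {j : ℕ} :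
    j ∈ VV R g K n (s ++ [b]) ↔ j ∈ VV R g K n s ∧ (b = false ↔ j ∈ R n (s ++ [false])) := by
  constructor
  · rintro ⟨⟨t, h1, h2, h3⟩, h4⟩
    refine ⟨⟨⟨t, h1, Or.inr ?_, h3⟩, ?_⟩, ?_⟩
    · have : t <+: s ++ [b] := by
        rcases h2 with h2 | h2
        · have := h2.length_le
          simp at this
          omega
        · exact h2
      exact List.prefix_of_prefix_length_le this (List.prefix_append _ _) (by omega)
    · intro i c hi hc
      obtain ⟨hi', -⟩ := List.getElem?_eq_some_iff.1 hc
      have := h4 i c hi (by rw [List.getElem?_append_left hi', hc])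
      rwa [List.take_append_of_le_length hi'.le] at this
    · have := h4 s.length b h (by simp)
      simpa using this
  · rintro ⟨⟨⟨t, h1, h2, h3⟩, h4⟩, h5⟩
    refine ⟨⟨t, h1, Or.inr ?_, h3⟩, ?_⟩
    · rcases h2 with h2 | h2
      · have := h2.eq_of_length (le_antisymm h2.length_le (by omega))
        rw [this]
        exact List.prefix_append _ _
      · exact h2.trans (List.prefix_append _ _)
    · intro i c hi hc
      obtain ⟨hi', -⟩ := List.getElem?_eq_some_iff.1 hc
      simp at hi'
      rcases lt_or_eq_of_le hi' with hlt | heq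
      · rw [List.getElem?_append_left hlt] at hc
        rw [List.take_append_of_le_length hlt.le]
        exact h4 i c hi hc
      · subst heq
        simp at hc
        subst hc
        simpa using h5

lemma VV_disj {R : ℕ → List Bool → Set ℕ} {g : ℕ → ℕ} {K : ℕ × List Bool → Set ℕ}
    (hK : ∀ e ∈ Bf g, ∀ e' ∈ Bf g, e ≠ e' → Disjoint (K e) (K e'))
    {n m : ℕ} {s t : List Bool} (h : basic n s ∩ basic m t = ∅) :
    VV R g K n s ∩ VV R g K m t = ∅ := by
  rw [Set.eq_empty_iff_forall_notMem]
  rintro j ⟨⟨⟨u, u1, u2, u3⟩, hs⟩, ⟨⟨v, v1, v2, v3⟩, ht⟩⟩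
  have huv : (n, u) = (m, v) := by
    by_contra hne
    exact Set.disjoint_left.1 (hK (n, u) u1 (m, v) v1 hne) u3 v3
  obtain ⟨rfl, rfl⟩ := Prod.mk.inj huv
  have hcomp : ∀ x : Cant, x ∈ cyl s → x ∉ cyl t := by
    intro x h1 h2
    have : ((n, x) : CSp) ∈ basic n s ∩ basic n t :=
      ⟨mem_basic_iff.2 ⟨rfl, h1⟩, mem_basic_iff.2 ⟨rfl, h2⟩⟩
    rw [h] at this
    exact this
  rcases trich s t with h1 | h1 | ⟨i, b, c, h1, h2, h3, h4⟩
  · exact hcomp (pt t) (cyl_mono h1 (pt_mem t)) (pt_mem t)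
  · exact hcomp (pt s) (pt_mem s) (cyl_mono h1 (pt_mem s))
  · by_cases hi : g n ≤ i
    · have e1 := hs i b hi h2
      have e2 := ht i c hi h3
      rw [h1] at e1
      have e3 := e1.trans e2.symm
      cases b <;> cases c <;> simp_all
    · have hiu : i < u.length := by omega
      have aux : ∀ w : List Bool, ∀ d, (w <+: u ∨ u <+: w) → w[i]? = some d → d = u[i] := by
        intro w d hw hd
        rcases hw with hw | hw
        · have := prefix_get hw hd
          rw [List.getElem?_eq_getElem hiu] at this
          exact (Option.some.inj this).symm
        · have := prefix_get hw (List.getElem?_eq_getElem hiu)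
          rw [hd] at this
          exact Option.some.inj this
      exact h4 ((aux s b u2 h2).trans (aux t c v2 h3).symm)

lemma VV_rep {φ : MAlg μ → PFin ℕ} (hφ : Paper.IsEmbedding μ φ) {g : ℕ → ℕ}
    {K : ℕ × List Bool → Set ℕ}
    (hK : ∀ n s, s.length = g n → PFin.mk (K (n, s)) = φ (classOf μ {(n, s)})) (n : ℕ)
    (s : List Bool) :
    PFin.mk (VV (fun n s => rep (φ (classOf μ {(n, s)}))) g K n s) = φ (classOf μ {(n, s)}) := by
  have hsmall : ∀ d, ∀ s : List Bool, s.length + d = g n →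
      PFin.mk (VV (fun n s => rep (φ (classOf μ {(n, s)}))) g K n s) = φ (classOf μ {(n, s)}) := by
    intro d
    induction d with
    | zero =>
      intro s hs
      rw [VV_eq (by omega)]
      exact hK n s (by omega)
    | succ d ih =>
      intro s hs
      rw [VV_split (by omega)]
      refine mk_union hφ ?_ (ih (s ++ [false]) (by simp; omega)) (ih (s ++ [true]) (by simp; omega))
      simp only [openSet_single]
      exact basic_split n s
  by_cases hle : s.length ≤ g n
  · exact hsmall (g n - s.length) s (by omega)
  · induction s using List.reverseRecOn with
    | nil => simp at hle
    | append_singleton s b ih =>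
      simp only [List.length_append, List.length_cons, List.length_nil, not_le] at hle
      have hs : PFin.mk (VV (fun n s => rep (φ (classOf μ {(n, s)}))) g K n s) =
          φ (classOf μ {(n, s)}) := by
        by_cases hle' : s.length ≤ g n
        · exact hsmall (g n - s.length) s (by omega)
        · exact ih hle'
      cases b
      · have := mk_inter hφ (O := {(n, s ++ [false])}) (X := {(n, s)}) (Y := {(n, s ++ [false])})
          (by simp only [openSet_single]; exact basic_false n s) hs (mk_rep _)
        rw [← this]
        congr 1
        ext j
        rw [VV_big (by omega)]
        simp
      · have := mk_sdiff hφ (O := {(n, s ++ [true])}) (X := {(n, s)}) (Y := {(n, s ++ [false])})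
          (by simp only [openSet_single]; exact basic_true n s) hs (mk_rep _)
        rw [← this]
        congr 1
        ext j
        rw [VV_big (by omega)]
        simp

lemma VV_open {R : ℕ → List Bool → Set ℕ} {g : ℕ → ℕ} {K : ℕ × List Bool → Set ℕ}
    {O : Set (ℕ × List Bool)} (hO : O ⊆ Bf g) {n : ℕ} {s : List Bool}
    (h : openSet O = basic n s) : VV R g K n s = {j | ∃ e ∈ O, j ∈ K e} := by
  have hsub : ∀ m t, (m, t) ∈ O → m = n ∧ s <+: t := by
    intro m t hmt
    have hc : ∀ x ∈ cyl t, ((m, x) : CSp) ∈ basic n s := by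
      intro x hx
      rw [← h]
      exact mem_openSet.2 ⟨t, hmt, hx⟩
    refine ⟨(mem_basic_iff.1 (hc _ (pt_mem t))).1, ?_⟩
    exact prefix_of_cyl fun x hx => (mem_basic_iff.1 (hc x hx)).2
  have hsup : ∀ t, t.length = g n → s <+: t → (n, t) ∈ O := by
    intro t ht hst
    have h1 : ((n, pt t) : CSp) ∈ openSet O := by
      rw [h]
      exact mem_basic_iff.2 ⟨rfl, cyl_mono hst (pt_mem t)⟩
    obtain ⟨t', h2, h3⟩ := mem_openSet.1 h1
    have e : t'.length = g n := hO h2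
    rw [eq_of_mem (pt_mem t) h3 (ht.trans e.symm)]
    exact h2
  have hlen : s.length ≤ g n := by
    have h1 : ((n, pt s) : CSp) ∈ openSet O := by
      rw [h]
      exact mem_basic_iff.2 ⟨rfl, pt_mem s⟩
    obtain ⟨t', h2, h3⟩ := mem_openSet.1 h1
    have e : t'.length = g n := hO h2
    have := (hsub n t' h2).2.length_le
    omega
  ext j
  rw [VV_small hlen]
  constructor
  · rintro ⟨t, h1, h2, h3⟩
    exact ⟨_, hsup t h1 h2, h3⟩
  · rintro ⟨⟨m, t⟩, h1, h2⟩
    obtain ⟨rfl, h3⟩ := hsub m t h1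
    exact ⟨t, hO h1, h3, h2⟩

lemma lift_final (hμ : IsMeasureOK μ) {φ : MAlg μ → PFin ℕ} (hφ : Paper.IsEmbedding μ φ)
    {g : ℕ → ℕ} {K : ℕ × List Bool → Set ℕ} {E : Set (ℕ × List Bool)} (hE : E ⊆ Bf g)
    (hKd : ∀ e ∈ Bf g, ∀ e' ∈ Bf g, e ≠ e' → Disjoint (K e) (K e'))
    (hK : ∀ n s, s.length = g n → PFin.mk (K (n, s)) = φ (classOf μ {(n, s)}))
    (hKE : ∀ O ⊆ E, PFin.mk {j | ∃ e ∈ O, j ∈ K e} = φ (classOf μ O)) :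
    ∃ Φ : MAlg μ → Set ℕ, IsLifting φ Φ ∧
        (∀ O ⊆ E, PhiSet Φ O = PhiUnion Φ O) ∧
        (∀ (n : ℕ) (s : List Bool) (m : ℕ) (t : List Bool),
          basic n s ∩ basic m t = ∅ → PhiPt Φ n s ∩ PhiPt Φ m t = ∅) := by
  classical
  let R : ℕ → List Bool → Set ℕ := fun n s => rep (φ (classOf μ {(n, s)}))
  let Φ : MAlg μ → Set ℕ := fun a =>
    if h : ∃ O, O ⊆ E ∧ a = classOf μ O then {j | ∃ e ∈ h.choose, j ∈ K e}
    else if h : ∃ p : ℕ × List Bool, a = classOf μ {(p.1, p.2)} then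
      VV R g K h.choose.1 h.choose.2
    else rep (φ a)
  have hO : ∀ O ⊆ E, Φ (classOf μ O) = {j | ∃ e ∈ O, j ∈ K e} := by
    intro O hOE
    have hex : ∃ O', O' ⊆ E ∧ classOf μ O = classOf μ O' := ⟨O, hOE, rfl⟩
    have h1 : Φ (classOf μ O) = {j | ∃ e ∈ hex.choose, j ∈ K e} := dif_pos hex
    obtain ⟨c1, c2⟩ := hex.choose_spec
    have h2 := clopen_eq hμ (isClopen_openSet (hOE.trans hE)) (isClopen_openSet (c1.trans hE)) c2
    have h3 : O = hex.choose := Subset.antisymm (openSet_inj (hOE.trans hE) (c1.trans hE) h2)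
      (openSet_inj (c1.trans hE) (hOE.trans hE) h2.symm)
    rw [h1, ← h3]
  have hP : ∀ n s, Φ (classOf μ {(n, s)}) = VV R g K n s := by
    intro n s
    by_cases hex : ∃ O, O ⊆ E ∧ classOf μ {(n, s)} = classOf μ O
    · obtain ⟨O, c1, c2⟩ := hex
      have h2 := clopen_eq hμ (by rw [openSet_single]; exact isClopen_basic n s)
        (isClopen_openSet (c1.trans hE)) c2
      rw [openSet_single] at h2
      rw [c2, hO O c1, VV_open (c1.trans hE) h2.symm]
    · have hex2 : ∃ p : ℕ × List Bool, classOf μ {(n, s)} = classOf μ {(p.1, p.2)} :=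
        ⟨(n, s), rfl⟩
      have h1 : Φ (classOf μ {(n, s)}) = VV R g K hex2.choose.1 hex2.choose.2 :=
        (dif_neg hex).trans (dif_pos hex2)
      have h2 := clopen_eq hμ (by rw [openSet_single]; exact isClopen_basic n s)
        (by rw [openSet_single]; exact isClopen_basic _ _) hex2.choose_spec
      rw [openSet_single, openSet_single] at h2
      obtain ⟨e1, e2⟩ := basic_inj h2
      rw [h1, ← e1, ← e2]
  refine ⟨Φ, ?_, ?_, ?_⟩
  · intro a
    by_cases hex : ∃ O, O ⊆ E ∧ a = classOf μ O
    · obtain ⟨O, c1, rfl⟩ := hex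
      rw [hO O c1]
      exact hKE O c1
    · by_cases hex2 : ∃ p : ℕ × List Bool, a = classOf μ {(p.1, p.2)}
      · obtain ⟨p, rfl⟩ := hex2
        rw [hP]
        exact VV_rep hφ hK _ _
      · have h1 : Φ a = rep (φ a) := (dif_neg hex).trans (dif_neg hex2)
        rw [h1, mk_rep]
  · intro O hOE
    show Φ (classOf μ O) = ⋃ p ∈ O, Φ (classOf μ {(p.1, p.2)})
    rw [hO O hOE]
    ext j
    simp only [mem_iUnion]
    constructor
    · rintro ⟨e, he, hj⟩
      refine ⟨e, he, ?_⟩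
      rw [hP, VV_eq (hE (hOE he))]
      exact hj
    · rintro ⟨e, he, hj⟩
      rw [hP, VV_eq (hE (hOE he))] at hj
      exact ⟨e, he, hj⟩
  · intro n s m t h
    show Φ (classOf μ {(n, s)}) ∩ Φ (classOf μ {(m, t)}) = ∅
    rw [hP, hP]
    exact VV_disj hKd h

end Lift


section Main

lemma countable_bdd (S : Set Ordinal) (hS : S.Countable) (hlt : ∀ α ∈ S, α < omega1) :
    ∃ β < omega1, ∀ α ∈ S, α < β := by
  have hw : omega1 = Ordinal.omega 1 := by simp [omega1]
  rw [hw] at hlt ⊢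
  rcases S.eq_empty_or_nonempty with rfl | hne
  · refine ⟨0, ?_, by simp⟩
    exact Ordinal.omega_pos 1
  · obtain ⟨g, rfl⟩ := hS.exists_eq_range hne
    refine ⟨⨆ n, Order.succ (g n), Ordinal.iSup_lt_omega_one ?_, ?_⟩
    · intro n
      exact (Cardinal.isSuccLimit_omega 1).succ_lt (hlt _ (mem_range_self n))
    · rintro _ ⟨n, rfl⟩
      exact lt_of_lt_of_le (Order.lt_succ (g n)) (Ordinal.le_iSup (fun n => Order.succ (g n)) n)

lemma lift_of_CA (hμ : IsMeasureOK μ) {φ : MAlg μ → PFin ℕ} (hφ : Paper.IsEmbedding μ φ)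
    (f : ℕ → ℕ) (A : Set ℕ) (hCA : CA (Psi φ f) (BfA f A)) :
    ∃ Φ : MAlg μ → Set ℕ, IsLifting φ Φ ∧
        (∀ O ⊆ BfA f A, PhiSet Φ O = PhiUnion Φ O) ∧
        (∀ (n : ℕ) (s : List Bool) (m : ℕ) (t : List Bool),
          basic n s ∩ basic m t = ∅ → PhiPt Φ n s ∩ PhiPt Φ m t = ∅) := by
  classical
  obtain ⟨K, hKd, hKE⟩ := hCA
  have hsub : BfA f A ⊆ Bf f := fun e he => he.2
  have hKE' : ∀ O ⊆ BfA f A, PFin.mk {j | ∃ e ∈ O, j ∈ K e} = φ (classOf μ O) := by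
    intro O hO
    rw [← aeq_iff.2 (hKE O hO), Psi, mk_rep, Set.inter_eq_left.2 (hO.trans hsub)]
  let U : Set ℕ := {j | ∃ e ∈ BfA f A, j ∈ K e}
  have hU : PFin.mk U = φ (classOf μ (BfA f A)) := hKE' _ Subset.rfl
  let R : ℕ → Set ℕ := fun n => rep (φ (classOf μ {(n, [])}))
  have hR : ∀ n, PFin.mk (R n) = φ (classOf μ {(n, [])}) := fun n => mk_rep _
  let D : ℕ → Set ℕ := fun n => {j | j ∈ R n ∧ j ∉ U ∧ ∀ m ∈ Iio n, m ∉ A → j ∉ R m}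
  have hD : ∀ n, n ∉ A → PFin.mk (D n) = φ (classOf μ {(n, [])}) := by
    intro n hn
    rw [← hR n, aeq_iff]
    have e1 : ∀ᶠ j in atTop, ¬ (j ∈ R n ∧ j ∈ U) := by
      refine ev_disj hφ ?_ (hR n) hU
      rw [openSet_single, Set.eq_empty_iff_forall_notMem]
      rintro p ⟨h1, h2⟩
      obtain ⟨t, h3, -⟩ := mem_openSet.1 h2
      rw [(mem_basic_iff.1 h1).1] at h3
      exact hn h3.1
    have e2 : ∀ᶠ j in atTop, ∀ m ∈ Iio n, ¬ (j ∈ R n ∧ j ∈ R m) := by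
      rw [Filter.eventually_all_finite (Set.finite_Iio n)]
      intro m hm
      refine ev_disj hφ ?_ (hR n) (hR m)
      rw [openSet_single, openSet_single, Set.eq_empty_iff_forall_notMem]
      rintro p ⟨h1, h2⟩
      have := (mem_basic_iff.1 h1).1.symm.trans (mem_basic_iff.1 h2).1
      exact (Nat.ne_of_gt hm) this
    filter_upwards [e1, e2] with j h1 h2
    constructor
    · intro h
      exact h.1
    · intro h
      exact ⟨h, fun h' => h1 ⟨h, h'⟩, fun m hm _ h' => h2 m hm ⟨h, h'⟩⟩
  let g : ℕ → ℕ := fun n => if n ∈ A then f n else 0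
  let K' : ℕ × List Bool → Set ℕ := fun e => if e.1 ∈ A then K e else D e.1
  have gA : ∀ n ∈ A, g n = f n := fun n hn => if_pos hn
  have gN : ∀ n, n ∉ A → g n = 0 := fun n hn => if_neg hn
  have kA : ∀ e : ℕ × List Bool, e.1 ∈ A → K' e = K e := fun e he => if_pos he
  have kN : ∀ e : ℕ × List Bool, e.1 ∉ A → K' e = D e.1 := fun e he => if_neg he
  have hKK : ∀ O ⊆ BfA f A, {j | ∃ e ∈ O, j ∈ K' e} = {j | ∃ e ∈ O, j ∈ K e} := by
    intro O hO
    ext j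
    constructor
    · rintro ⟨e, he, hj⟩
      rw [kA e (hO he).1] at hj
      exact ⟨e, he, hj⟩
    · rintro ⟨e, he, hj⟩
      refine ⟨e, he, ?_⟩
      rw [kA e (hO he).1]
      exact hj
  have hBg : ∀ e ∈ Bf g, e.1 ∈ A → e ∈ BfA f A := by
    intro e he hA
    have h1 : e.2.length = g e.1 := he
    exact ⟨hA, h1.trans (gA _ hA)⟩
  have hBn : ∀ e ∈ Bf g, e.1 ∉ A → e.2 = [] := by
    intro e he hA
    have h1 : e.2.length = g e.1 := he
    rw [gN _ hA] at h1
    exact List.length_eq_zero_iff.1 h1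
  refine lift_final hμ hφ (g := g) (K := K') (E := BfA f A) ?_ ?_ ?_ ?_
  · intro e he
    show e.2.length = g e.1
    rw [gA _ he.1]
    exact he.2
  · have aux : ∀ e ∈ Bf g, ∀ e' ∈ Bf g, e.1 ∈ A → e'.1 ∉ A → Disjoint (K' e) (K' e') := by
      intro e he e' he' h1 h2
      rw [kA e h1, kN e' h2, Set.disjoint_left]
      intro j hj hj'
      exact hj'.2.1 ⟨e, hBg e he h1, hj⟩
    have aux2 : ∀ n m, n ∉ A → n < m → Disjoint (D n) (D m) := by
      intro n m hn hlt
      rw [Set.disjoint_left]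
      intro j hj hj'
      exact hj'.2.2 n hlt hn hj.1
    intro e he e' he' hne
    by_cases h1 : e.1 ∈ A <;> by_cases h2 : e'.1 ∈ A
    · rw [kA e h1, kA e' h2]
      exact hKd e (hBg e he h1) e' (hBg e' he' h2) hne
    · exact aux e he e' he' h1 h2
    · exact (aux e' he' e he h2 h1).symm
    · have hne1 : e.1 ≠ e'.1 := fun h =>
        hne (Prod.ext h ((hBn e he h1).trans (hBn e' he' h2).symm))
      rw [kN e h1, kN e' h2]
      rcases lt_or_gt_of_ne hne1 with h | h
      · exact aux2 _ _ h1 h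
      · exact (aux2 _ _ h2 h).symm
  · intro n s hs
    by_cases hn : n ∈ A
    · have hmem : (n, s) ∈ BfA f A := hBg (n, s) hs hn
      have h1 := hKE' {(n, s)} (singleton_subset_iff.2 hmem)
      rw [kA (n, s) hn, ← h1]
      congr 1
      ext j
      constructor
      · intro hj
        exact ⟨_, rfl, hj⟩
      · rintro ⟨e, rfl, hj⟩
        exact hj
    · have : s = [] := hBn (n, s) hs hn
      subst this
      rw [kN (n, []) hn]
      exact hD n hn
  · intro O hO
    rw [hKK O hO]
    exact hKE' O hO

lemma finite_layer (π : ℕ ≃ List Bool) (f : ℕ → ℕ) (L : ℕ) :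
    {e : ℕ × List Bool | e ∈ Bf f ∧ (π e.1).length ≤ L}.Finite := by
  have h1 : {n : ℕ | (π n).length ≤ L}.Finite := by
    have := (List.finite_length_le Bool L).preimage (f := π) π.injective.injOn
    exact this
  have h2 : (⋃ n ∈ {n : ℕ | (π n).length ≤ L}, (fun s => (n, s)) ''
      {s : List Bool | s.length = f n}).Finite :=
    h1.biUnion fun n _ => (List.finite_length_eq Bool (f n)).image _
  refine h2.subset ?_
  rintro ⟨n, s⟩ ⟨h3, h4⟩
  exact mem_biUnion (show n ∈ {n : ℕ | (π n).length ≤ L} from h4) ⟨s, h3, rfl⟩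

end Main


end Helpers

/-- assume OCA; let `φ : ℳ → P(ℕ)/fin` be an embedding and `⟨A_α : α < ω₁⟩`
enumerate a neat almost disjoint family of infinite subsets of `ℕ`.  Then for every `f`
there is `β < ω₁` such that for every `α` with `β ≤ α < ω₁` there is a lifting `Φ` of `φ`
with `Φ(O) = Φ[O]` for all `O ⊆ B_{f,A_α}` and `Φ(n,s) ∩ Φ(m,t) = ∅` whenever
`{n} × [s]` and `{m} × [t]` are disjoint. -/
theorem locally_complete_lifting (oca : OCA)
    (μ : Measure CSp) (hμ : IsMeasureOK μ)
    (φ : MAlg μ → PFin ℕ) (hφ : IsEmbedding μ φ)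
    (A : Ordinal → Set ℕ)
    (hinj : ∀ α < omega1, ∀ β < omega1, α ≠ β → A α ≠ A β)
    (hinf : ∀ α < omega1, (A α).Infinite)
    (had : ∀ α < omega1, ∀ β < omega1, α ≠ β → (A α ∩ A β).Finite)
    (hneat : ∃ (π : ℕ ≃ List Bool) (br : Ordinal → ℕ → Bool),
        (∀ α < omega1, ∀ n ∈ A α, ∃ k : ℕ, π n = List.ofFn fun i : Fin k => br α i.1) ∧
        (∀ α < omega1, ∀ β < omega1, α ≠ β → br α ≠ br β))
    (f : ℕ → ℕ) :
    ∃ β < omega1, ∀ α, β ≤ α → α < omega1 →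
      ∃ Φ : MAlg μ → Set ℕ, IsLifting φ Φ ∧
        (∀ O ⊆ BfA f (A α), PhiSet Φ O = PhiUnion Φ O) ∧
        (∀ (n : ℕ) (s : List Bool) (m : ℕ) (t : List Bool),
          basic n s ∩ basic m t = ∅ → PhiPt Φ n s ∩ PhiPt Φ m t = ∅) := by
  obtain ⟨π, br, hbr, hbri⟩ := hneat
  let S : Set Ordinal := {α | α < omega1 ∧ ¬ CA (Psi φ f) (BfA f (A α))}
  have hSc : S.Countable := by
    have himg : (br '' S).Countable := by
      refine groups (Ψ := Psi φ f) (node := fun e : ℕ × List Bool => π e.1) (Bs := Bf f) oca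
        (homMod_Psi hφ f) (finite_layer π f) (br '' S) ?_
      rintro _ ⟨α, ⟨hα, hn⟩, rfl⟩ hCA
      refine hn (hCA.mono ?_)
      intro e he
      exact ⟨he.2, hbr α hα e.1 he.1⟩
    refine Set.countable_of_injective_of_countable_image ?_ himg
    intro α hα β hβ h
    by_contra hne
    exact hbri α hα.1 β hβ.1 hne h
  obtain ⟨β, hβ, hb⟩ := countable_bdd S hSc (fun α hα => hα.1)
  refine ⟨β, hβ, fun α hle hlt => ?_⟩
  apply lift_of_CA hμ hφ
  by_contra hn
  exact absurd (hb α ⟨hlt, hn⟩) (not_lt.2 hle)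


end Paper
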